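/- arXiv:2306.11944 — 8 statements merged into one kernel-verified Lean document; each statement's English description precedes it below -/
import Mathlib

section
/- For every x, x̄ ∈ X, if y₁ ∈ Y maximizes 𝓛_μ(x,·) over Y and y₂ ∈ Y maximizes 𝓛_μ(x̄,·) over Y, then ‖y₁ − y₂‖ ≤ (L_yx/μ)·‖x − x̄‖. In particular, the solution map x ↦ y*_μ(x) of the regularized maximization problem is (L_yx/μ)-Lipschitz continuous on X. -/
open scoped RealInnerProductSpace

/-- Partial gradient of `L` in the second (dual) variable. -/
noncomputable def gradY {E F : Type*} [NormedAddCommGroup F] [InnerProductSpace ℝ F]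
    [CompleteSpace F] (L : E → F → ℝ) (x : E) (y : F) : F :=
  gradient (fun y' => L x y') y

/-- The regularized function `𝓛_μ(x,y) = 𝓛(x,y) − (μ/2)‖y − y₀‖²`. -/
noncomputable def Lreg {E F : Type*} [NormedAddCommGroup F] [InnerProductSpace ℝ F]
    (L : E → F → ℝ) (μ : ℝ) (y₀ : F) (x : E) (y : F) : ℝ :=
  L x y - μ / 2 * ‖y - y₀‖ ^ 2

open AffineMap in
/-- The gradient of a concave function is a monotonically decreasing operator. -/
lemma ConcaveOn.inner_gradient_sub_nonpos {F : Type*} [NormedAddCommGroup F]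
    [InnerProductSpace ℝ F] [CompleteSpace F] {s : Set F} {f : F → ℝ} (hf : ConcaveOn ℝ s f)
    {a b g h : F} (ha : a ∈ s) (hb : b ∈ s) (hfa : HasGradientAt f g a)
    (hfb : HasGradientAt f h b) : ⟪g - h, a - b⟫ ≤ 0 := by
  have hconc := hf.comp_affineMap (lineMap (k := ℝ) a b)
  have hderiv : ∀ (t : ℝ) (v : F), HasGradientAt f v (lineMap a b t) →
      HasDerivAt (f ∘ lineMap a b) ⟪v, b - a⟫ t := fun t v hv => by
    simpa using hv.hasFDerivAt.comp_hasDerivAt t hasDerivAt_lineMap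
  have h₀ : (0 : ℝ) ∈ lineMap a b ⁻¹' s := by simpa using ha
  have h₁ : (1 : ℝ) ∈ lineMap a b ⁻¹' s := by simpa using hb
  have hle₀ := hconc.slope_le_of_hasDerivAt h₀ h₁ zero_lt_one (hderiv 0 g (by simpa using hfa))
  have hle₁ := hconc.le_slope_of_hasDerivAt h₀ h₁ zero_lt_one (hderiv 1 h (by simpa using hfb))
  rw [← neg_sub b a, inner_neg_right, inner_sub_left]
  linarith

/-- First-order optimality condition for the maximum of a differentiable function over a
convex set. -/
lemma IsMaxOn.inner_gradient_sub_nonpos {F : Type*} [NormedAddCommGroup F]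
    [InnerProductSpace ℝ F] [CompleteSpace F] {s : Set F} {f : F → ℝ} {a b g : F}
    (hmax : IsMaxOn f s a) (hs : Convex ℝ s) (ha : a ∈ s) (hb : b ∈ s)
    (hf : HasGradientAt f g a) : ⟪g, b - a⟫ ≤ 0 := by
  simpa using hmax.localize.hasFDerivWithinAt_nonpos hf.hasFDerivAt.hasFDerivWithinAt
    (sub_mem_posTangentConeAt_of_segment_subset (hs.segment_subset ha hb))

lemma hasGradientAt_gradY {E F : Type*} [NormedAddCommGroup E] [NormedSpace ℝ E]
    [NormedAddCommGroup F] [InnerProductSpace ℝ F] [CompleteSpace F] {L : E → F → ℝ}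
    (hL : Differentiable ℝ (fun p : E × F => L p.1 p.2)) (x : E) (y : F) :
    HasGradientAt (L x) (gradY L x y) y := by
  have h : Differentiable ℝ (L x) :=
    hL.comp ((differentiable_const x).prodMk differentiable_id)
  exact (h y).hasGradientAt

lemma HasGradientAt.lreg {E F : Type*} [NormedAddCommGroup F] [InnerProductSpace ℝ F]
    [CompleteSpace F] {L : E → F → ℝ} {x : E} {y g : F} (hL : HasGradientAt (L x) g y)
    (μ : ℝ) (y₀ : F) : HasGradientAt (Lreg L μ y₀ x) (g - μ • (y - y₀)) y := by
  rw [hasGradientAt_iff_hasFDerivAt]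
  refine (hL.hasFDerivAt.sub
    ((((hasFDerivAt_id y).sub_const y₀).norm_sq).const_mul (μ / 2))).congr_fderiv ?_
  ext v
  simp
  ring

/-- Lemma `lmu`: the maximizers of the regularized objective `𝓛_μ(x,·)` over `Y`
are `(L_yx/μ)`-Lipschitz as a function of `x`. -/
theorem stmt_1 {E F : Type*}
    [NormedAddCommGroup E] [InnerProductSpace ℝ E] [FiniteDimensional ℝ E]
    [NormedAddCommGroup F] [InnerProductSpace ℝ F] [FiniteDimensional ℝ F]
    (X : Set E) (Y : Set F)
    (hXne : X.Nonempty) (hXconv : Convex ℝ X) (hXcomp : IsCompact X)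
    (hYne : Y.Nonempty) (hYconv : Convex ℝ Y) (hYcomp : IsCompact Y)
    (L : E → F → ℝ) (hLdiff : Differentiable ℝ (fun p : E × F => L p.1 p.2))
    (hconc : ∀ x ∈ X, ConcaveOn ℝ Set.univ (L x))
    (Lyx : ℝ) (hLyx : 0 < Lyx)
    (hlipy : ∀ x ∈ X, ∀ x' ∈ X, ∀ y ∈ Y,
      ‖gradY L x y - gradY L x' y‖ ≤ Lyx * ‖x - x'‖)
    (μ : ℝ) (hμ : 0 < μ) (y₀ : F) (hy₀ : y₀ ∈ Y)
    (x x' : E) (hx : x ∈ X) (hx' : x' ∈ X)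
    (y₁ y₂ : F) (hy₁ : y₁ ∈ Y) (hy₂ : y₂ ∈ Y)
    (hmax₁ : ∀ y ∈ Y, Lreg L μ y₀ x y ≤ Lreg L μ y₀ x y₁)
    (hmax₂ : ∀ y ∈ Y, Lreg L μ y₀ x' y ≤ Lreg L μ y₀ x' y₂) :
    ‖y₁ - y₂‖ ≤ Lyx / μ * ‖x - x'‖ := by
  have hg₁ := hasGradientAt_gradY hLdiff x y₁
  have hg₂ := hasGradientAt_gradY hLdiff x' y₂
  have hg := hasGradientAt_gradY hLdiff x' y₁
  have hopt₁ := IsMaxOn.inner_gradient_sub_nonpos (isMaxOn_iff.2 hmax₁) hYconv hy₁ hy₂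
    (hg₁.lreg μ y₀)
  have hopt₂ := IsMaxOn.inner_gradient_sub_nonpos (isMaxOn_iff.2 hmax₂) hYconv hy₂ hy₁
    (hg₂.lreg μ y₀)
  have hmono := (hconc x' hx').inner_gradient_sub_nonpos (Set.mem_univ y₁) (Set.mem_univ y₂)
    hg hg₂
  have hcs : ⟪gradY L x y₁ - gradY L x' y₁, y₁ - y₂⟫ ≤ Lyx * ‖x - x'‖ * ‖y₁ - y₂‖ :=
    (real_inner_le_norm _ _).trans
      (mul_le_mul_of_nonneg_right (hlipy x hx x' hx' y₁ hy₁) (norm_nonneg _))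
  have hsq : μ * (‖y₁ - y₂‖ * ‖y₁ - y₂‖) ≤ Lyx * ‖x - x'‖ * ‖y₁ - y₂‖ := by
    rw [← real_inner_self_eq_norm_mul_norm]
    simp only [inner_sub_left, inner_sub_right, real_inner_smul_left] at *
    linarith
  rw [div_mul_eq_mul_div, le_div_iff₀ hμ]
  rcases (norm_nonneg (y₁ - y₂)).eq_or_lt with h | h
  · rw [← h, zero_mul]
    positivity
  · exact le_of_mul_le_mul_right (by linarith) h
end

section
/- For every μ > 0, the function f_μ(x) := max_{y∈Y} 𝓛_μ(x,y) is well defined with the maximum attained at a unique point y*_μ(x) ∈ Y for each x ∈ 𝒳; moreover f_μ is differentiable on 𝒳 with gradient ∇f_μ(x) = ∇ₓ𝓛(x, y*_μ(x)), and ∇f_μ is Lipschitz continuous on X with constant L_xx + L_yx²/μ, i.e. ‖∇f_μ(x) − ∇f_μ(x̄)‖ ≤ (L_xx + L_yx²/μ)·‖x − x̄‖ for all x, x̄ ∈ X. -/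
open scoped RealInnerProductSpace

/-- Partial gradient of `L` in the first (primal) variable. -/
noncomputable def gradX {E F : Type*} [NormedAddCommGroup E] [InnerProductSpace ℝ E]
    [CompleteSpace E] (L : E → F → ℝ) (x : E) (y : F) : E :=
  gradient (fun x' => L x' y) x

/-- Quadratic growth of the regularized function away from a maximizer. -/
lemma Lreg_add_le_of_isMax {E F : Type*} [NormedAddCommGroup F] [InnerProductSpace ℝ F]
    {Y : Set F} (hY : Convex ℝ Y) {L : E → F → ℝ} {μ : ℝ} {y₀ : F} {x : E}
    (hconc : ConcaveOn ℝ Set.univ (L x)) {y z : F} (hy : y ∈ Y) (hz : z ∈ Y)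
    (hmax : ∀ w ∈ Y, Lreg L μ y₀ x w ≤ Lreg L μ y₀ x z) :
    Lreg L μ y₀ x y + μ / 2 * ‖y - z‖ ^ 2 ≤ Lreg L μ y₀ x z := by
  have key : ∀ t : ℝ, 0 < t → t < 1 →
      Lreg L μ y₀ x y + μ / 2 * (1 - t) * ‖y - z‖ ^ 2 ≤ Lreg L μ y₀ x z := by
    intro t ht ht1
    have hmid := hmax _ (hY hz hy (sub_nonneg.2 ht1.le) ht.le (by ring))
    have hc := hconc.2 (Set.mem_univ z) (Set.mem_univ y) (sub_nonneg.2 ht1.le) ht.le (by ring)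
    have hn : ‖(1 - t) • z + t • y - y₀‖ ^ 2
        = (1 - t) * ‖z - y₀‖ ^ 2 + t * ‖y - y₀‖ ^ 2 - t * (1 - t) * ‖y - z‖ ^ 2 := by
      have h1 : (1 - t) • z + t • y - y₀ = (1 - t) • (z - y₀) + t • (y - y₀) := by module
      have h2 : y - z = (y - y₀) - (z - y₀) := by abel
      rw [h1, h2, norm_add_sq_real, norm_sub_sq_real (y - y₀), norm_smul, norm_smul, mul_pow, mul_pow,
        Real.norm_eq_abs, Real.norm_eq_abs, sq_abs, sq_abs, inner_smul_left, inner_smul_right,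
        real_inner_comm]
      simp only [conj_trivial]
      ring
    simp only [Lreg, smul_eq_mul] at hmid hc ⊢
    rw [hn] at hmid
    refine le_of_mul_le_mul_left ?_ ht
    linear_combination hmid + hc
  have hlim : Filter.Tendsto
      (fun t : ℝ => Lreg L μ y₀ x y + μ / 2 * (1 - t) * ‖y - z‖ ^ 2) (nhdsWithin 0 (Set.Ioi 0))
      (nhds (Lreg L μ y₀ x y + μ / 2 * (1 - 0) * ‖y - z‖ ^ 2)) :=
    (Continuous.tendsto (by fun_prop) 0).mono_left nhdsWithin_le_nhds
  rw [sub_zero, mul_one] at hlim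
  refine le_of_tendsto hlim ?_
  filter_upwards [Ioo_mem_nhdsGT (zero_lt_one' ℝ)] with t ht
  exact key t ht.1 ht.2

/-- Maximizers of the regularized function depend on `x` in a Lipschitz way. -/
lemma norm_maximizer_sub_le {E F : Type*} [NormedAddCommGroup E]
    [NormedAddCommGroup F] [InnerProductSpace ℝ F] [CompleteSpace F]
    {Y : Set F} (hY : Convex ℝ Y) {L : E → F → ℝ} {K μ : ℝ} (hK : 0 ≤ K) (hμ : 0 < μ) {y₀ : F}
    {x x' : E} (hdiff : ∀ x, Differentiable ℝ (L x))
    (hlip : ∀ y ∈ Y, ‖gradY L x y - gradY L x' y‖ ≤ K * ‖x - x'‖)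
    (hconc : ∀ x, ConcaveOn ℝ Set.univ (L x)) {y y' : F} (hy : y ∈ Y) (hy' : y' ∈ Y)
    (hmax : ∀ w ∈ Y, Lreg L μ y₀ x w ≤ Lreg L μ y₀ x y)
    (hmax' : ∀ w ∈ Y, Lreg L μ y₀ x' w ≤ Lreg L μ y₀ x' y') :
    ‖y - y'‖ ≤ K / μ * ‖x - x'‖ := by
  have h1 := Lreg_add_le_of_isMax hY (hconc x) hy' hy hmax
  have h2 := Lreg_add_le_of_isMax hY (hconc x') hy hy' hmax'
  have h3 : ‖(L x y - L x' y) - (L x y' - L x' y')‖ ≤ K * ‖x - x'‖ * ‖y - y'‖ := by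
    refine hY.norm_image_sub_le_of_norm_hasFDerivWithin_le (f := fun w => L x w - L x' w)
      (fun w _ => ((hdiff x w).hasGradientAt.hasFDerivAt.sub
        (hdiff x' w).hasGradientAt.hasFDerivAt).hasFDerivWithinAt) (fun w hw => ?_) hy' hy
    rw [← map_sub, LinearIsometryEquiv.norm_map]
    exact hlip w hw
  have h4 := (le_abs_self _).trans h3
  rw [norm_sub_rev y' y] at h1
  simp only [Lreg] at h1 h2
  have h5 : μ * ‖y - y'‖ * ‖y - y'‖ ≤ K * ‖x - x'‖ * ‖y - y'‖ := by
    linear_combination h1 + h2 + h4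
  rw [div_mul_eq_mul_div, le_div_iff₀ hμ]
  rcases (norm_nonneg (y - y')).eq_or_lt with h0 | h0
  · rw [← h0, zero_mul]
    positivity
  · linarith [le_of_mul_le_mul_right h5 h0]

/-- First-order expansion of `L` in `x` around `x`, with the gradient frozen at another `y`. -/
lemma abs_sub_sub_inner_gradX_le {E F : Type*} [NormedAddCommGroup E] [InnerProductSpace ℝ E]
    [CompleteSpace E] [NormedAddCommGroup F] {Y : Set F} {L : E → F → ℝ} {A B : ℝ} (hA : 0 ≤ A)
    (hdiff : ∀ y, Differentiable ℝ fun x => L x y)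
    (hlip : ∀ (x x' : E), ∀ y ∈ Y, ∀ y' ∈ Y,
      ‖gradX L x y - gradX L x' y'‖ ≤ A * ‖x - x'‖ + B * ‖y - y'‖)
    (x x' : E) {y z : F} (hy : y ∈ Y) (hz : z ∈ Y) :
    |L x' y - L x y - ⟪gradX L x z, x' - x⟫|
      ≤ (A * ‖x' - x‖ + B * ‖y - z‖) * ‖x' - x‖ := by
  have h := (convex_segment (𝕜 := ℝ) x x').norm_image_sub_le_of_norm_hasFDerivWithin_le'
    (f := fun u => L u y) (φ := InnerProductSpace.toDual ℝ E (gradX L x z))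
    (C := A * ‖x' - x‖ + B * ‖y - z‖)
    (fun u _ => (hdiff y u).hasGradientAt.hasFDerivAt.hasFDerivWithinAt) (fun u hu => ?_)
    (left_mem_segment ℝ x x') (right_mem_segment ℝ x x')
  · simpa only [InnerProductSpace.toDual_apply_apply, Real.norm_eq_abs] using h
  · rw [← map_sub, LinearIsometryEquiv.norm_map]
    refine (hlip u x y hy z hz).trans ?_
    gcongr
    obtain ⟨a, b, ha, hb, hab, rfl⟩ := hu
    have hu' : a • x + b • x' - x = b • (x' - x) := by
      rw [eq_sub_of_add_eq hab]
      module
    rw [hu', norm_smul, Real.norm_of_nonneg hb]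
    exact mul_le_of_le_one_left (norm_nonneg _) (by linarith)

/-- A function with a quadratic first-order error has the corresponding gradient. -/
lemma hasGradientAt_of_abs_sub_le_sq {E : Type*} [NormedAddCommGroup E] [InnerProductSpace ℝ E]
    [CompleteSpace E] {f : E → ℝ} {g x : E} {C : ℝ}
    (h : ∀ x', |f x' - f x - ⟪g, x' - x⟫| ≤ C * ‖x' - x‖ ^ 2) : HasGradientAt f g x := by
  rw [hasGradientAt_iff_isLittleO]
  refine (Asymptotics.IsBigO.of_bound C (g := fun x' => ‖x' - x‖ ^ 2) (.of_forall fun x' => ?_))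
    |>.trans_isLittleO (Asymptotics.isLittleO_pow_sub_sub x one_lt_two)
  simpa using h x'

/-- `f_μ(x) = max_{y∈Y} 𝓛_μ(x,y)` is well defined, attained at a unique
point `y*_μ(x)`, differentiable with `∇f_μ(x) = ∇ₓ𝓛(x,y*_μ(x))`, and `∇f_μ` is
Lipschitz on `X` with constant `L_xx + L_yx²/μ`. -/
theorem stmt_2 {E F : Type*}
    [NormedAddCommGroup E] [InnerProductSpace ℝ E] [FiniteDimensional ℝ E]
    [NormedAddCommGroup F] [InnerProductSpace ℝ F] [FiniteDimensional ℝ F]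
    (X : Set E) (Y : Set F)
    (hXne : X.Nonempty) (hXconv : Convex ℝ X) (hXcomp : IsCompact X)
    (hYne : Y.Nonempty) (hYconv : Convex ℝ Y) (hYcomp : IsCompact Y)
    (L : E → F → ℝ) (hLdiff : ContDiff ℝ 1 (fun p : E × F => L p.1 p.2))
    (Lxx Lyy Lyx : ℝ) (hLxx : 0 ≤ Lxx) (hLyy : 0 ≤ Lyy) (hLyx : 0 < Lyx)
    (hlipx : ∀ (x x' : E), ∀ y ∈ Y, ∀ y' ∈ Y,
      ‖gradX L x y - gradX L x' y'‖ ≤ Lxx * ‖x - x'‖ + Lyx * ‖y - y'‖)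
    (hlipy : ∀ (x x' : E), ∀ y ∈ Y, ∀ y' ∈ Y,
      ‖gradY L x y - gradY L x' y'‖ ≤ Lyx * ‖x - x'‖ + Lyy * ‖y - y'‖)
    (hconc : ∀ x : E, ConcaveOn ℝ Set.univ (L x))
    (μ : ℝ) (hμ : 0 < μ) (y₀ : F) (hy₀ : y₀ ∈ Y) :
    ∃ ystar : E → F, ∃ fμ : E → ℝ,
      (∀ x : E, ystar x ∈ Y ∧
        (∀ y ∈ Y, Lreg L μ y₀ x y ≤ Lreg L μ y₀ x (ystar x)) ∧
        (∀ y ∈ Y, (∀ y' ∈ Y, Lreg L μ y₀ x y' ≤ Lreg L μ y₀ x y) → y = ystar x)) ∧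
      (∀ x : E, fμ x = Lreg L μ y₀ x (ystar x)) ∧
      Differentiable ℝ fμ ∧
      (∀ x : E, gradient fμ x = gradX L x (ystar x)) ∧
      (∀ x ∈ X, ∀ x' ∈ X,
        ‖gradient fμ x - gradient fμ x'‖ ≤ (Lxx + Lyx ^ 2 / μ) * ‖x - x'‖) := by
  have hdx : ∀ y, Differentiable ℝ fun x => L x y := fun y =>
    (hLdiff.differentiable one_ne_zero).comp (differentiable_id.prodMk (differentiable_const y))
  have hdy : ∀ x, Differentiable ℝ (L x) := fun x =>
    (hLdiff.differentiable one_ne_zero).comp ((differentiable_const x).prodMk differentiable_id)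
  have hex : ∀ x, ∃ y ∈ Y, ∀ w ∈ Y, Lreg L μ y₀ x w ≤ Lreg L μ y₀ x y := by
    intro x
    have hc : Continuous fun y => Lreg L μ y₀ x y := by
      have := (hdy x).continuous
      unfold Lreg
      fun_prop
    exact hYcomp.exists_isMaxOn hYne hc.continuousOn
  choose ys hys hmax using hex
  have hLip : ∀ x x', ‖ys x - ys x'‖ ≤ Lyx / μ * ‖x - x'‖ := fun x x' =>
    norm_maximizer_sub_le hYconv hLyx.le hμ hdy
      (fun y hy => by simpa using hlipy x x' y hy y hy) hconc (hys x) (hys x') (hmax x) (hmax x')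
  have hgrad : ∀ x, HasGradientAt (fun x => Lreg L μ y₀ x (ys x)) (gradX L x (ys x)) x := by
    intro x
    refine hasGradientAt_of_abs_sub_le_sq (C := Lxx + Lyx * (Lyx / μ)) fun x' => ?_
    have h1 := abs_le.1 (abs_sub_sub_inner_gradX_le hLxx hdx hlipx x x' (hys x) (hys x))
    have h2 := abs_le.1 (abs_sub_sub_inner_gradX_le hLxx hdx hlipx x x' (hys x') (hys x))
    have h3 := hmax x _ (hys x')
    have h4 := hmax x' _ (hys x)
    have h5 := mul_le_mul_of_nonneg_right
      (mul_le_mul_of_nonneg_left (hLip x' x) hLyx.le) (norm_nonneg (x' - x))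
    have h6 : 0 ≤ Lyx * (Lyx / μ) * ‖x' - x‖ ^ 2 := by positivity
    rw [sub_self, norm_zero] at h1
    simp only [Lreg] at h3 h4 ⊢
    refine abs_le.2 ⟨?_, ?_⟩
    · linear_combination h1.1 + h4 + h6
    · linear_combination h2.2 + h3 + h5
  refine ⟨ys, fun x => Lreg L μ y₀ x (ys x), fun x => ⟨hys x, hmax x, fun y hy hy' => ?_⟩,
    fun _ => rfl, fun x => (hgrad x).differentiableAt, fun x => (hgrad x).gradient,
    fun x _ x' _ => ?_⟩
  · simpa [sub_eq_zero] using norm_maximizer_sub_le (x := x) (x' := x) hYconv hLyx.le hμ hdy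
      (fun w _ => by simp) hconc hy (hys x) hy' (hmax x)
  · rw [(hgrad x).gradient, (hgrad x').gradient]
    refine (hlipx x x' _ (hys x) _ (hys x')).trans ?_
    linear_combination Lyx * hLip x x'
end

section
/- Let Y ⊆ 𝒴 be an α-strongly convex set for some α > 0, let g ∈ 𝒴, and let p ∈ Y satisfy ⟨g, y⟩ ≤ ⟨g, p⟩ for all y ∈ Y. Then for every y ∈ Y, ⟨y − p, g⟩ ≤ −(α/4)·‖y − p‖²·‖g‖. -/
open scoped RealInnerProductSpace

/-- if `Y` is an `α`-strongly convex set and `p ∈ Y` maximizes `⟨g,·⟩` over `Y`,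
then for every `y ∈ Y`, `⟨y − p, g⟩ ≤ −(α/4)‖y − p‖²‖g‖`. -/
theorem stmt_4 {F : Type*}
    [NormedAddCommGroup F] [InnerProductSpace ℝ F] [FiniteDimensional ℝ F]
    (Y : Set F) (α : ℝ) (hα : 0 < α)
    (hYsc : ∀ u ∈ Y, ∀ v ∈ Y, ∀ γ ∈ Set.Icc (0 : ℝ) 1, ∀ w : F, ‖w‖ = 1 →
      γ • u + (1 - γ) • v + (γ * (1 - γ) * (α / 2) * ‖u - v‖ ^ 2) • w ∈ Y)
    (g : F) (p : F) (hp : p ∈ Y)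
    (hpmax : ∀ y ∈ Y, ⟪g, y⟫ ≤ ⟪g, p⟫) :
    ∀ y ∈ Y, ⟪y - p, g⟫ ≤ -(α / 4) * ‖y - p‖ ^ 2 * ‖g‖ := by
  intro y hy
  rcases eq_or_ne g 0 with rfl | hg
  · simp
  have hg0 : ‖g‖ ≠ 0 := norm_ne_zero_iff.mpr hg
  have hw : ‖(‖g‖⁻¹ : ℝ) • g‖ = 1 := by
    rw [norm_smul, norm_inv, norm_norm, inv_mul_cancel₀ hg0]
  have hmid := hpmax _ (hYsc y hy p hp (1 / 2) (by norm_num) _ hw)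
  have hgw : ⟪g, (‖g‖⁻¹ : ℝ) • g⟫ = ‖g‖ := by
    rw [real_inner_smul_right, real_inner_self_eq_norm_sq]
    field_simp
  rw [inner_add_right, inner_add_right, real_inner_smul_right g y,
    real_inner_smul_right g p, real_inner_smul_right g (_ • g), hgw] at hmid
  rw [real_inner_comm, inner_sub_right]
  linarith
end

section
/- Assume in addition that Y is α-strongly convex for some α > 0 and fix μ > 0 and y₀ ∈ Y. Let (x,y) ∈ X×Y and τ ∈ [0,1]; let s ∈ X satisfy ⟨∇ₓ𝓛(x,y), s⟩ ≤ ⟨∇ₓ𝓛(x,y), x'⟩ for all x' ∈ X and set x⁺ = τ·s + (1−τ)·x. Let g = ∇_y𝓛(x,y) − μ(y − y₀), let p ∈ Y satisfy ⟨g, p⟩ ≥ ⟨g, y'⟩ for all y' ∈ Y, set σ = min{1, (α/(4(L_yy+μ)))·‖g‖} and y⁺ = σ·p + (1−σ)·y. Then H(x⁺, y⁺) ≤ max{1/2, 1 − (α·√μ/(8·√2·(L_yy+μ)))·√(H(x,y))}·H(x,y) + L_yx·τ·D_Y·D_X + 2·L_xx·τ²·D_X². -/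
open scoped RealInnerProductSpace

section FirstOrder

variable {V : Type*} [NormedAddCommGroup V] [InnerProductSpace ℝ V] [CompleteSpace V]

theorem HasGradientAt.hasDerivAt_add_smul {f : V → ℝ} {G a d : V} {t : ℝ}
    (h : HasGradientAt f G (a + t • d)) :
    HasDerivAt (fun t : ℝ => f (a + t • d)) ⟪G, d⟫ t := by
  have hl : HasDerivAt (fun t : ℝ => a + t • d) d t := by
    simpa using ((hasDerivAt_id t).smul_const d).const_add a
  exact h.hasFDerivAt.comp_hasDerivAt t hl

theorem ConcaveOn.le_add_inner_gradient {f : V → ℝ} (hf : ConcaveOn ℝ Set.univ f)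
    {a : V} (hd : DifferentiableAt ℝ f a) (b : V) :
    f b ≤ f a + ⟪gradient f a, b - a⟫ := by
  have hc : ConcaveOn ℝ Set.univ (fun t : ℝ => f (a + t • (b - a))) := by
    have := hf.comp_affineMap (AffineMap.lineMap (k := ℝ) a b)
    simpa [Function.comp_def, AffineMap.lineMap_apply, add_comm] using this
  have hder : HasDerivAt (fun t : ℝ => f (a + t • (b - a))) ⟪gradient f a, b - a⟫ 0 :=
    HasGradientAt.hasDerivAt_add_smul (by simpa using hd.hasGradientAt)
  have := hc.slope_le_of_hasDerivAt (Set.mem_univ _) (Set.mem_univ 1) one_pos hder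
  simp only [slope_def_field, one_smul, zero_smul, add_zero, add_sub_cancel, sub_zero,
    div_one] at this
  linarith

/-- The descent lemma for a function whose gradient is Lipschitz on a convex set. -/
theorem add_inner_gradient_sub_le_of_lipschitz {f : V → ℝ} (hd : Differentiable ℝ f)
    {S : Set V} (hS : Convex ℝ S) {K : ℝ} {a b : V} (ha : a ∈ S) (hb : b ∈ S)
    (hK : ∀ u ∈ S, ‖gradient f u - gradient f a‖ ≤ K * ‖u - a‖) :
    f a + ⟪gradient f a, b - a⟫ - K / 2 * ‖b - a‖ ^ 2 ≤ f b := by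
  set d := b - a with hdd
  have hder (t : ℝ) : HasDerivAt
      (fun t : ℝ => f (a + t • d) - t * ⟪gradient f a, d⟫ + t ^ 2 * (K / 2 * ‖d‖ ^ 2))
      (⟪gradient f (a + t • d), d⟫ - 1 * ⟪gradient f a, d⟫
        + (2 * t) * (K / 2 * ‖d‖ ^ 2)) t := by
    refine ((HasGradientAt.hasDerivAt_add_smul (hd _).hasGradientAt).sub
      ((hasDerivAt_id t).mul_const _)).add (HasDerivAt.mul_const ?_ _)
    simpa using hasDerivAt_pow 2 t
  have hmono := monotoneOn_of_deriv_nonneg (convex_Icc (0 : ℝ) 1)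
    (fun t _ => (hder t).continuousAt.continuousWithinAt)
    (fun t _ => (hder t).differentiableAt.differentiableWithinAt)
    (fun t ht => by
      rw [interior_Icc] at ht
      rw [(hder t).deriv]
      have hmem : a + t • d ∈ S := hS.add_smul_sub_mem ha hb ⟨ht.1.le, ht.2.le⟩
      have h1 := hK _ hmem
      rw [add_sub_cancel_left, norm_smul, Real.norm_of_nonneg ht.1.le] at h1
      have h2 := (abs_le.mp (abs_real_inner_le_norm (gradient f (a + t • d) - gradient f a) d)).1
      rw [inner_sub_left] at h2
      nlinarith [mul_le_mul_of_nonneg_right h1 (norm_nonneg d)])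
  have := hmono (Set.left_mem_Icc.2 zero_le_one) (Set.right_mem_Icc.2 zero_le_one) zero_le_one
  simp only [zero_smul, one_smul, add_zero, zero_mul, one_mul, sub_zero, one_pow, hdd,
    add_sub_cancel, zero_pow two_ne_zero] at this
  rw [hdd]
  linarith

theorem abs_sub_sub_sub_le_of_norm_gradient_sub_le {f₁ f₂ : V → ℝ} (h₁ : Differentiable ℝ f₁)
    (h₂ : Differentiable ℝ f₂) {S : Set V} (hS : Convex ℝ S) {C : ℝ}
    (hC : ∀ u ∈ S, ‖gradient f₁ u - gradient f₂ u‖ ≤ C) {a b : V} (ha : a ∈ S) (hb : b ∈ S) :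
    |(f₁ b - f₂ b) - (f₁ a - f₂ a)| ≤ C * ‖b - a‖ := by
  refine hS.norm_image_sub_le_of_norm_hasFDerivWithin_le (𝕜 := ℝ) (f := fun u => f₁ u - f₂ u)
    (fun u _ => ((h₁ u).hasGradientAt.hasFDerivAt.sub
      (h₂ u).hasGradientAt.hasFDerivAt).hasFDerivWithinAt) (fun u hu => ?_) ha hb
  rw [← map_sub, LinearIsometryEquiv.norm_map]
  exact hC u hu

end FirstOrder

/-- A maximizer `p` of a linear functional over an `α`-strongly convex set satisfies a quadratic
growth inequality. -/
theorem inner_sub_ge_of_strongly_convex {F : Type*} [NormedAddCommGroup F]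
    [InnerProductSpace ℝ F] {Y : Set F} {α : ℝ}
    (hYsc : ∀ u ∈ Y, ∀ v ∈ Y, ∀ γ ∈ Set.Icc (0 : ℝ) 1, ∀ w : F, ‖w‖ = 1 →
      γ • u + (1 - γ) • v + (γ * (1 - γ) * (α / 2) * ‖u - v‖ ^ 2) • w ∈ Y)
    {g p y : F} (hp : p ∈ Y) (hy : y ∈ Y) (hpmax : ∀ y' ∈ Y, ⟪g, y'⟫ ≤ ⟪g, p⟫) :
    α / 4 * ‖g‖ * ‖p - y‖ ^ 2 ≤ ⟪g, p - y⟫ := by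
  rcases eq_or_ne g 0 with rfl | hg
  · simp
  have hg' : ‖g‖ ≠ 0 := norm_ne_zero_iff.2 hg
  have h := hpmax _ (hYsc p hp y hy (1 / 2) ⟨by norm_num, by norm_num⟩ (‖g‖⁻¹ • g)
    (by rw [norm_smul, norm_inv, norm_norm, inv_mul_cancel₀ hg']))
  have hgg : ‖g‖⁻¹ * ‖g‖ ^ 2 = ‖g‖ := by field_simp
  simp only [inner_add_right, inner_smul_right, real_inner_self_eq_norm_sq, hgg] at h
  rw [inner_sub_right]
  linarith

theorem Lreg_le_add_inner_sub {E F : Type*} [NormedAddCommGroup F] [InnerProductSpace ℝ F]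
    [CompleteSpace F] {L : E → F → ℝ} {x : E} (hc : ConcaveOn ℝ Set.univ (L x)) {y : F}
    (hd : DifferentiableAt ℝ (L x) y) (μ : ℝ) (y₀ z : F) :
    Lreg L μ y₀ x z ≤ Lreg L μ y₀ x y + ⟪gradY L x y - μ • (y - y₀), z - y⟫
      - μ / 2 * ‖z - y‖ ^ 2 := by
  have h := hc.le_add_inner_gradient hd z
  have hn : ‖z - y₀‖ ^ 2 = ‖z - y‖ ^ 2 + 2 * ⟪z - y, y - y₀⟫ + ‖y - y₀‖ ^ 2 := by
    rw [← norm_add_sq_real, sub_add_sub_cancel]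
  rw [real_inner_comm] at hn
  simp only [Lreg, gradY, inner_sub_left _ (μ • _), real_inner_smul_left, hn]
  linarith

theorem Lreg_add_inner_sub_le {E F : Type*} [NormedAddCommGroup F] [InnerProductSpace ℝ F]
    [CompleteSpace F] {L : E → F → ℝ} {x : E} (hd : Differentiable ℝ (L x))
    {Y : Set F} (hY : Convex ℝ Y) {K : ℝ} {y z : F} (hy : y ∈ Y) (hz : z ∈ Y)
    (hK : ∀ u ∈ Y, ‖gradY L x u - gradY L x y‖ ≤ K * ‖u - y‖) (μ : ℝ) (y₀ : F) :
    Lreg L μ y₀ x y + ⟪gradY L x y - μ • (y - y₀), z - y⟫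
      - (K + μ) / 2 * ‖z - y‖ ^ 2 ≤ Lreg L μ y₀ x z := by
  have h := add_inner_gradient_sub_le_of_lipschitz hd hY hy hz hK
  have hn : ‖z - y₀‖ ^ 2 = ‖z - y‖ ^ 2 + 2 * ⟪z - y, y - y₀⟫ + ‖y - y₀‖ ^ 2 := by
    rw [← norm_add_sq_real, sub_add_sub_cancel]
  rw [real_inner_comm] at hn
  simp only [Lreg, gradY, inner_sub_left _ (μ • _), real_inner_smul_left, hn]
  linarith

/-- One Frank–Wolfe step in the dual variable contracts the primal-fixed gap. -/
theorem Lreg_gap_dual_step_le {E F : Type*} [NormedAddCommGroup F] [InnerProductSpace ℝ F]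
    [CompleteSpace F] {L : E → F → ℝ} {x : E} (hd : Differentiable ℝ (L x))
    (hc : ConcaveOn ℝ Set.univ (L x)) {Y : Set F} (hY : Convex ℝ Y) {α : ℝ} (hα : 0 < α)
    (hYsc : ∀ u ∈ Y, ∀ v ∈ Y, ∀ γ ∈ Set.Icc (0 : ℝ) 1, ∀ w : F, ‖w‖ = 1 →
      γ • u + (1 - γ) • v + (γ * (1 - γ) * (α / 2) * ‖u - v‖ ^ 2) • w ∈ Y)
    {K μ : ℝ} (hK₀ : 0 ≤ K) (hμ : 0 < μ) {y₀ y z p g : F} (hy : y ∈ Y) (hz : z ∈ Y)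
    (hzy : Lreg L μ y₀ x y ≤ Lreg L μ y₀ x z)
    (hK : ∀ u ∈ Y, ‖gradY L x u - gradY L x y‖ ≤ K * ‖u - y‖)
    (hg : g = gradY L x y - μ • (y - y₀)) (hp : p ∈ Y) (hpmax : ∀ y' ∈ Y, ⟪g, y'⟫ ≤ ⟪g, p⟫)
    {σ : ℝ} (hσ : σ = min 1 (α / (4 * (K + μ)) * ‖g‖)) :
    Lreg L μ y₀ x z - Lreg L μ y₀ x (σ • p + (1 - σ) • y) ≤
      max (1 / 2) (1 - α * Real.sqrt μ / (8 * Real.sqrt 2 * (K + μ)) *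
          Real.sqrt (Lreg L μ y₀ x z - Lreg L μ y₀ x y)) *
        (Lreg L μ y₀ x z - Lreg L μ y₀ x y) := by
  have hKμ : 0 < K + μ := by positivity
  have hσ0 : 0 ≤ σ := by rw [hσ]; positivity
  have hσ1 : σ ≤ 1 := hσ ▸ min_le_left _ _
  have hσg : (K + μ) * σ ≤ α / 4 * ‖g‖ := by
    calc (K + μ) * σ ≤ (K + μ) * (α / (4 * (K + μ)) * ‖g‖) := by
          gcongr; exact hσ ▸ min_le_right _ _
      _ = α / 4 * ‖g‖ := by field_simp
  have hup := Lreg_le_add_inner_sub hc (hd y) μ y₀ z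
  have hlow := Lreg_add_inner_sub_le hd hY hy
    (hY hp hy hσ0 (sub_nonneg.2 hσ1) (add_sub_cancel σ 1)) hK μ y₀
  rw [← hg] at hup hlow
  have hstep : σ • p + (1 - σ) • y - y = σ • (p - y) := by module
  rw [hstep, real_inner_smul_right, norm_smul, Real.norm_of_nonneg hσ0] at hlow
  have hquad := inner_sub_ge_of_strongly_convex hYsc hp hy hpmax
  have hzp : ⟪g, z - y⟫ ≤ ⟪g, p - y⟫ := by
    rw [inner_sub_right, inner_sub_right]; linarith [hpmax z hz]
  set H := Lreg L μ y₀ x z - Lreg L μ y₀ x y with hH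
  have hH0 : 0 ≤ H := sub_nonneg.2 hzy
  have hHp : H ≤ ⟪g, p - y⟫ := by nlinarith [sq_nonneg ‖z - y‖]
  have hcurv : (K + μ) / 2 * (σ * ‖p - y‖) ^ 2 ≤ σ / 2 * ⟪g, p - y⟫ := by
    calc (K + μ) / 2 * (σ * ‖p - y‖) ^ 2
        = σ / 2 * (((K + μ) * σ) * ‖p - y‖ ^ 2) := by ring
      _ ≤ σ / 2 * (α / 4 * ‖g‖ * ‖p - y‖ ^ 2) := by gcongr
      _ ≤ _ := by gcongr
  have hgain : Lreg L μ y₀ x z - Lreg L μ y₀ x (σ • p + (1 - σ) • y) ≤ (1 - σ / 2) * H := by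
    nlinarith [mul_le_mul_of_nonneg_left hHp hσ0]
  refine hgain.trans (mul_le_mul_of_nonneg_right ?_ hH0)
  rcases min_choice 1 (α / (4 * (K + μ)) * ‖g‖) with h | h
  · refine le_max_of_le_left ?_
    rw [hσ, h]; norm_num
  · refine le_max_of_le_right ?_
    have hgH : 2 * μ * H ≤ ‖g‖ ^ 2 := by
      have h1 : H ≤ ‖g‖ * ‖z - y‖ - μ / 2 * ‖z - y‖ ^ 2 := by
        linarith [real_inner_le_norm g (z - y)]
      nlinarith [sq_nonneg (‖g‖ - μ * ‖z - y‖)]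
    have hsqrt : √μ / √2 * √H ≤ ‖g‖ := by
      rw [← Real.sqrt_div hμ.le, ← Real.sqrt_mul (by positivity)]
      exact Real.sqrt_le_iff.2 ⟨norm_nonneg g, by nlinarith [mul_nonneg hμ.le hH0]⟩
    have : α * √μ / (8 * √2 * (K + μ)) * √H = α / (8 * (K + μ)) * (√μ / √2 * √H) := by
      field_simp
    rw [this, hσ, h]
    have h2 : α / (8 * (K + μ)) * (√μ / √2 * √H) ≤ α / (8 * (K + μ)) * ‖g‖ := by gcongr
    have h3 : α / (4 * (K + μ)) * ‖g‖ / 2 = α / (8 * (K + μ)) * ‖g‖ := by field_simp; ring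
    linarith

/-- Lemma 1, one-step analysis of R-PDCG: with `H(x,y) =
`𝓛_μ(x,y*_μ(x)) − 𝓛_μ(x,y)`, one R-PDCG step satisfies
`H(x⁺,y⁺) ≤ max{1/2, 1 − (α√μ/(8√2(L_yy+μ)))√H(x,y)}·H(x,y) + L_yx τ D_Y D_X + 2 L_xx τ² D_X²`. -/
theorem stmt_5 {E F : Type*}
    [NormedAddCommGroup E] [InnerProductSpace ℝ E] [FiniteDimensional ℝ E]
    [NormedAddCommGroup F] [InnerProductSpace ℝ F] [FiniteDimensional ℝ F]
    (X : Set E) (Y : Set F)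
    (hXne : X.Nonempty) (hXconv : Convex ℝ X) (hXcomp : IsCompact X)
    (hYne : Y.Nonempty) (hYconv : Convex ℝ Y) (hYcomp : IsCompact Y)
    (L : E → F → ℝ) (hLdiff : Differentiable ℝ (fun p : E × F => L p.1 p.2))
    (Lxx Lyy Lyx : ℝ) (hLxx : 0 ≤ Lxx) (hLyy : 0 ≤ Lyy) (hLyx : 0 < Lyx)
    (hlipx : ∀ x ∈ X, ∀ x' ∈ X, ∀ y ∈ Y, ∀ y' ∈ Y,
      ‖gradX L x y - gradX L x' y'‖ ≤ Lxx * ‖x - x'‖ + Lyx * ‖y - y'‖)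
    (hlipy : ∀ x ∈ X, ∀ x' ∈ X, ∀ y ∈ Y, ∀ y' ∈ Y,
      ‖gradY L x y - gradY L x' y'‖ ≤ Lyx * ‖x - x'‖ + Lyy * ‖y - y'‖)
    (hconc : ∀ x ∈ X, ConcaveOn ℝ Set.univ (L x))
    (α : ℝ) (hα : 0 < α)
    (hYsc : ∀ u ∈ Y, ∀ v ∈ Y, ∀ γ ∈ Set.Icc (0 : ℝ) 1, ∀ w : F, ‖w‖ = 1 →
      γ • u + (1 - γ) • v + (γ * (1 - γ) * (α / 2) * ‖u - v‖ ^ 2) • w ∈ Y)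
    (μ : ℝ) (hμ : 0 < μ) (y₀ : F) (hy₀ : y₀ ∈ Y)
    (ystar : E → F)
    (hystar : ∀ x ∈ X, ystar x ∈ Y ∧
      ∀ y ∈ Y, Lreg L μ y₀ x y ≤ Lreg L μ y₀ x (ystar x))
    (x : E) (hx : x ∈ X) (y : F) (hy : y ∈ Y)
    (τ : ℝ) (hτ : τ ∈ Set.Icc (0 : ℝ) 1)
    (s : E) (hsX : s ∈ X)
    (hsmin : ∀ x' ∈ X, ⟪gradX L x y, s⟫ ≤ ⟪gradX L x y, x'⟫)
    (xp : E) (hxp : xp = τ • s + (1 - τ) • x)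
    (g : F) (hg : g = gradY L x y - μ • (y - y₀))
    (p : F) (hpY : p ∈ Y) (hpmax : ∀ y' ∈ Y, ⟪g, y'⟫ ≤ ⟪g, p⟫)
    (σ : ℝ) (hσ : σ = min 1 (α / (4 * (Lyy + μ)) * ‖g‖))
    (yp : F) (hyp : yp = σ • p + (1 - σ) • y) :
    Lreg L μ y₀ xp (ystar xp) - Lreg L μ y₀ xp yp ≤
      max (1 / 2)
          (1 - α * Real.sqrt μ / (8 * Real.sqrt 2 * (Lyy + μ)) *
            Real.sqrt (Lreg L μ y₀ x (ystar x) - Lreg L μ y₀ x y)) *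
        (Lreg L μ y₀ x (ystar x) - Lreg L μ y₀ x y)
      + Lyx * τ * Metric.diam Y * Metric.diam X
      + 2 * Lxx * τ ^ 2 * Metric.diam X ^ 2 := by
  subst hyp
  have hdx (b : F) : Differentiable ℝ (fun a => L a b) :=
    hLdiff.comp (differentiable_id.prodMk (differentiable_const b))
  have hdy (a : E) : Differentiable ℝ (L a) :=
    hLdiff.comp ((differentiable_const a).prodMk differentiable_id)
  have hσ0 : 0 ≤ σ := by
    have : 0 < Lyy + μ := by positivity
    rw [hσ]; positivity
  have hσ1 : σ ≤ 1 := hσ ▸ min_le_left _ _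
  have hypY : σ • p + (1 - σ) • y ∈ Y :=
    hYconv hpY hy hσ0 (sub_nonneg.2 hσ1) (add_sub_cancel σ 1)
  have hxpX : xp ∈ X :=
    hxp ▸ hXconv hsX hx hτ.1 (sub_nonneg.2 hτ.2) (add_sub_cancel τ 1)
  have hdual := Lreg_gap_dual_step_le (hdy x) (hconc x hx) hYconv hα hYsc hLyy hμ hy
    (hystar x hx).1 ((hystar x hx).2 y hy)
    (fun u hu => by simpa using hlipy x hx x hx u hu y hy) hg hpY hpmax hσ
  have hmove := abs_sub_sub_sub_le_of_norm_gradient_sub_le (hdx (ystar xp))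
    (hdx (σ • p + (1 - σ) • y)) hXconv (C := Lyx * Metric.diam Y)
    (fun u hu => by
      have h := hlipx u hu u hu _ (hystar xp hxpX).1 _ hypY
      rw [sub_self, norm_zero, mul_zero, zero_add] at h
      refine h.trans (mul_le_mul_of_nonneg_left ?_ hLyx.le)
      rw [← dist_eq_norm]
      exact Metric.dist_le_diam_of_mem hYcomp.isBounded (hystar xp hxpX).1 hypY) hx hxpX
  have hdist : ‖xp - x‖ ≤ τ * Metric.diam X := by
    have : xp - x = τ • (s - x) := by rw [hxp]; module
    rw [this, norm_smul, Real.norm_of_nonneg hτ.1, ← dist_eq_norm]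
    exact mul_le_mul_of_nonneg_left (Metric.dist_le_diam_of_mem hXcomp.isBounded hsX hx) hτ.1
  have hbound : Lyx * Metric.diam Y * ‖xp - x‖ ≤ Lyx * τ * Metric.diam Y * Metric.diam X := by
    calc _ ≤ Lyx * Metric.diam Y * (τ * Metric.diam X) :=
          mul_le_mul_of_nonneg_left hdist (mul_nonneg hLyx.le Metric.diam_nonneg)
      _ = _ := by ring
  have hopt := (hystar x hx).2 _ (hystar xp hxpX).1
  have hextra : 0 ≤ 2 * Lxx * τ ^ 2 * Metric.diam X ^ 2 := by positivity
  have hle := (le_abs_self _).trans hmove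
  refine le_trans ?_ (add_le_add_left (add_le_add_left hdual _) _)
  simp only [Lreg] at hopt ⊢
  linarith
end

section
/- For every μ > 0, fixed y₀ ∈ Y, and every (x,y) ∈ X×Y, the dual gap G_Y(x,y) := sup_{y'∈Y} ⟨∇_y𝓛(x,y), y' − y⟩ satisfies G_Y(x,y) ≤ (2 + L_yy/μ)·H(x,y) + μ·D_Y². -/
open scoped RealInnerProductSpace

/-- If the gradient of `f` is `K`-Lipschitz at `y` relative to a convex set, then along a segment of
the set issuing from `y` the function is bounded below by its linearization up to a quadratic
error. -/
theorem inner_gradient_sub_le_of_lipschitz {F : Type*} [NormedAddCommGroup F]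
    [InnerProductSpace ℝ F] [CompleteSpace F] {f : F → ℝ} (hf : Differentiable ℝ f)
    {Y : Set F} (hY : Convex ℝ Y) {K : ℝ} (hK : 0 ≤ K) {y y' : F} (hy : y ∈ Y) (hy' : y' ∈ Y)
    (hlip : ∀ z ∈ Y, ‖gradient f z - gradient f y‖ ≤ K * ‖z - y‖)
    {t : ℝ} (ht : 0 < t) (ht1 : t ≤ 1) :
    t * ⟪gradient f y, y' - y⟫ - K * t ^ 2 * ‖y' - y‖ ^ 2 ≤ f (y + t • (y' - y)) - f y := by
  have hderiv : ∀ s : ℝ, HasDerivAt (fun s : ℝ => f (y + s • (y' - y)))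
      ⟪gradient f (y + s • (y' - y)), y' - y⟫ s := fun s => by
    have h₁ : HasDerivAt (fun s : ℝ => y + s • (y' - y)) (y' - y) s := by
      simpa using ((hasDerivAt_id s).smul_const (y' - y)).const_add y
    exact (hf (y + s • (y' - y))).hasGradientAt.hasFDerivAt.comp_hasDerivAt s h₁
  obtain ⟨s, ⟨hs0, hst⟩, hs⟩ := exists_hasDerivAt_eq_slope _ _ ht
    (fun s _ => (hderiv s).continuousAt.continuousWithinAt) (fun s _ => hderiv s)
  have hz : y + s • (y' - y) ∈ Y :=
    hY.add_smul_sub_mem hy hy' ⟨hs0.le, hst.le.trans ht1⟩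
  have hnorm : ‖gradient f (y + s • (y' - y)) - gradient f y‖ ≤ K * (t * ‖y' - y‖) := by
    refine (hlip _ hz).trans ?_
    rw [add_sub_cancel_left, norm_smul, Real.norm_of_nonneg hs0.le]
    gcongr
  have hinner : -(K * (t * ‖y' - y‖) * ‖y' - y‖) ≤
      ⟪gradient f (y + s • (y' - y)) - gradient f y, y' - y⟫ := by
    refine le_trans ?_ (neg_le_of_abs_le (abs_real_inner_le_norm _ _))
    gcongr
  rw [inner_sub_left, hs] at hinner
  simp only [zero_smul, add_zero, sub_zero] at hinner
  have := mul_le_mul_of_nonneg_left hinner ht.le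
  rw [mul_sub, mul_div_cancel₀ _ ht.ne'] at this
  linarith

/-- the dual gap `G_Y(x,y) = sup_{y'∈Y} ⟨∇_y𝓛(x,y), y'−y⟩` satisfies
`G_Y(x,y) ≤ (2 + L_yy/μ)·H(x,y) + μ·D_Y²` where `H(x,y) = 𝓛_μ(x,y*_μ(x)) − 𝓛_μ(x,y)`. -/
theorem stmt_6 {E F : Type*}
    [NormedAddCommGroup E] [InnerProductSpace ℝ E] [FiniteDimensional ℝ E]
    [NormedAddCommGroup F] [InnerProductSpace ℝ F] [FiniteDimensional ℝ F]
    (X : Set E) (Y : Set F)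
    (hXne : X.Nonempty) (hXconv : Convex ℝ X) (hXcomp : IsCompact X)
    (hYne : Y.Nonempty) (hYconv : Convex ℝ Y) (hYcomp : IsCompact Y)
    (L : E → F → ℝ) (hLdiff : Differentiable ℝ (fun p : E × F => L p.1 p.2))
    (Lyy : ℝ) (hLyy : 0 ≤ Lyy)
    (hlipy : ∀ x ∈ X, ∀ y ∈ Y, ∀ y' ∈ Y,
      ‖gradY L x y - gradY L x y'‖ ≤ Lyy * ‖y - y'‖)
    (hconc : ∀ x ∈ X, ConcaveOn ℝ Set.univ (L x))
    (μ : ℝ) (hμ : 0 < μ) (y₀ : F) (hy₀ : y₀ ∈ Y)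
    (ystar : E → F)
    (hystar : ∀ x ∈ X, ystar x ∈ Y ∧
      ∀ y ∈ Y, Lreg L μ y₀ x y ≤ Lreg L μ y₀ x (ystar x))
    (x : E) (hx : x ∈ X) (y : F) (hy : y ∈ Y) :
    sSup ((fun y' => ⟪gradY L x y, y' - y⟫) '' Y) ≤
      (2 + Lyy / μ) * (Lreg L μ y₀ x (ystar x) - Lreg L μ y₀ x y)
      + μ * Metric.diam Y ^ 2 := by
  refine csSup_le (hYne.image _) ?_
  rintro _ ⟨y', hy', rfl⟩
  have hf : Differentiable ℝ (L x) :=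
    hLdiff.comp ((differentiable_const x).prodMk differentiable_id)
  have hM : 0 < Lyy + μ := by positivity
  obtain ⟨t, ht⟩ : ∃ t, t = μ / (Lyy + μ) := ⟨_, rfl⟩
  have ht0 : 0 < t := ht ▸ by positivity
  have htM : t * (Lyy + μ) = μ := by rw [ht]; field_simp
  have ht1 : t ≤ 1 := by rw [ht, div_le_one hM]; linarith
  have hlin := inner_gradient_sub_le_of_lipschitz hf hYconv hLyy hy hy'
    (fun z hz => hlipy x hx z hz y hy) ht0 ht1
  change t * ⟪gradY L x y, y' - y⟫ - _ ≤ _ at hlin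
  have hmax := (hystar x hx).2 _ (hYconv.add_smul_sub_mem hy hy' ⟨ht0.le, ht1⟩)
  have hH : 0 ≤ Lreg L μ y₀ x (ystar x) - Lreg L μ y₀ x y :=
    sub_nonneg.2 ((hystar x hx).2 y hy)
  have hdiam : ∀ z ∈ Y, ∀ w ∈ Y, ‖z - w‖ ^ 2 ≤ Metric.diam Y ^ 2 := fun z hz w hw => by
    rw [← dist_eq_norm]
    gcongr
    exact Metric.dist_le_diam_of_mem hYcomp.isBounded hz hw
  have hexp : ‖y + t • (y' - y) - y₀‖ ^ 2 =
      ‖y - y₀‖ ^ 2 + 2 * t * ⟪y - y₀, y' - y⟫ + t ^ 2 * ‖y' - y‖ ^ 2 := by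
    rw [add_sub_right_comm, norm_add_sq_real, inner_smul_right, norm_smul, mul_pow,
      Real.norm_eq_abs, sq_abs]
    ring
  have hpol : ‖y' - y₀‖ ^ 2 = ‖y - y₀‖ ^ 2 + 2 * ⟪y - y₀, y' - y⟫ + ‖y' - y‖ ^ 2 := by
    rw [← norm_add_sq_real, sub_add_sub_cancel']
  have hD₀ := hdiam y' hy' y₀ hy₀
  have hD := hdiam y' hy' y hy
  generalize hHdef : Lreg L μ y₀ x (ystar x) - Lreg L μ y₀ x y = H at hH ⊢
  have hstep : t * ⟪gradY L x y, y' - y⟫ ≤ H + t * (t * Lyy * ‖y' - y‖ ^ 2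
      + μ * ⟪y - y₀, y' - y⟫ + μ * t / 2 * ‖y' - y‖ ^ 2) := by
    have hsub : Lreg L μ y₀ x (y + t • (y' - y)) - Lreg L μ y₀ x y ≤ H := by linarith
    simp only [Lreg] at hsub
    rw [hexp] at hsub
    linarith
  have hc : t * (1 + Lyy / μ) = 1 := by
    rw [ht]; field_simp; ring
  have hgap : ⟪gradY L x y, y' - y⟫ ≤ (1 + Lyy / μ) * H + (t * Lyy * ‖y' - y‖ ^ 2
      + μ * ⟪y - y₀, y' - y⟫ + μ * t / 2 * ‖y' - y‖ ^ 2) := by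
    refine le_of_mul_le_mul_left ?_ ht0
    rw [mul_add, ← mul_assoc, hc, one_mul]
    exact hstep
  have hcoef : (t * Lyy + μ * t / 2) * ‖y' - y‖ ^ 2 ≤ μ * ‖y' - y‖ ^ 2 := by
    gcongr
    nlinarith [mul_pos hμ ht0]
  have hprox : μ * ⟪y - y₀, y' - y⟫ ≤ μ * ((Metric.diam Y ^ 2 - ‖y' - y‖ ^ 2) / 2) := by
    gcongr
    nlinarith [sq_nonneg ‖y - y₀‖]
  have hμD := mul_le_mul_of_nonneg_left hD hμ.le
  linarith
end

section
/- Assume in addition that Y is α-strongly convex for some α > 0 and fix (x₀,y₀) ∈ X×Y. There exists a constant C > 0, depending only on 𝓛, X, Y, x₀, y₀, L_xx, L_yx, L_yy and α, such that for every integer K ≥ 2, the R-PDCG iterates generated with parameters μ = K^{−1/6} and τ = K^{−5/6} admit an index t ∈ {⌈K/2⌉, …, K−1} with G_X(x_t,y_t) + G_Y(x_t,y_t) ≤ C·K^{−1/6}. -/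
open scoped RealInnerProductSpace

section Hilbert

variable {G : Type*} [NormedAddCommGroup G] [InnerProductSpace ℝ G]

/-- Frank-Wolfe gap lower bound on an `α`-strongly convex set. -/
theorem norm_mul_sq_le_inner_of_stronglyConvex {S : Set G} {α : ℝ}
    (hS : ∀ u ∈ S, ∀ v ∈ S, ∀ γ ∈ Set.Icc (0 : ℝ) 1, ∀ w : G, ‖w‖ = 1 →
      γ • u + (1 - γ) • v + (γ * (1 - γ) * (α / 2) * ‖u - v‖ ^ 2) • w ∈ S)
    {g p y : G} (hp : p ∈ S) (hy : y ∈ S) (hmax : ∀ z ∈ S, ⟪g, z⟫ ≤ ⟪g, p⟫) :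
    α / 4 * ‖g‖ * ‖p - y‖ ^ 2 ≤ ⟪g, p - y⟫ := by
  rcases eq_or_ne g 0 with rfl | hg
  · simp
  have hg' : ‖g‖ ≠ 0 := norm_ne_zero_iff.2 hg
  have hw : ‖(‖g‖⁻¹ • g)‖ = 1 := by
    rw [norm_smul, norm_inv, norm_norm, inv_mul_cancel₀ hg']
  have h := hmax _ (hS p hp y hy (1 / 2) ⟨by norm_num, by norm_num⟩ _ hw)
  have hgg : ‖g‖⁻¹ * ⟪g, g⟫ = ‖g‖ := by
    rw [real_inner_self_eq_norm_sq]; field_simp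
  rw [inner_add_right, inner_add_right, inner_smul_right, inner_smul_right, inner_smul_right,
    inner_smul_right, hgg] at h
  rw [inner_sub_right]
  linarith

/-- The Tikhonov-regularized concave function `f - μ/2 ‖· - c‖²`. -/
noncomputable def tikhonov (f : G → ℝ) (μ : ℝ) (c y : G) : ℝ := f y - μ / 2 * ‖y - c‖ ^ 2

/-- Quadratic growth at a maximizer, with the constant given by the midpoint argument. -/
theorem ConcaveOn.tikhonov_growth {f : G → ℝ} (hf : ConcaveOn ℝ Set.univ f) {S : Set G}
    (hS : Convex ℝ S) {μ : ℝ} {c z y : G} (hz : z ∈ S) (hy : y ∈ S)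
    (hmax : ∀ u ∈ S, tikhonov f μ c u ≤ tikhonov f μ c z) :
    μ / 4 * ‖z - y‖ ^ 2 ≤ tikhonov f μ c z - tikhonov f μ c y := by
  have h0 : (0 : ℝ) ≤ 1 / 2 := by norm_num
  have h1 := hmax _ (hS hz hy h0 h0 (by norm_num))
  have h2 := hf.2 (Set.mem_univ z) (Set.mem_univ y) h0 h0 (by norm_num)
  have h3 := parallelogram_law_with_norm ℝ (z - c) (y - c)
  have h4 : (1 / 2 : ℝ) • z + (1 / 2 : ℝ) • y - c = (1 / 2 : ℝ) • ((z - c) + (y - c)) := by module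
  have h5 : z - c - (y - c) = z - y := by abel
  rw [h5] at h3
  have h6 : ‖z - y‖ ^ 2 = 2 * (‖z - c‖ ^ 2 + ‖y - c‖ ^ 2) - ‖z - c + (y - c)‖ ^ 2 := by linarith
  simp only [tikhonov, h4, norm_smul, smul_eq_mul, mul_pow] at h1 h2 ⊢
  norm_num at h1
  rw [h6]
  linarith

variable [CompleteSpace G]

theorem HasGradientAt.hasDerivAt_comp_line {f : G → ℝ} {g a d : G} {t : ℝ}
    (h : HasGradientAt f g (a + t • d)) :
    HasDerivAt (fun t : ℝ => f (a + t • d)) ⟪g, d⟫ t := by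
  have hl : HasDerivAt (fun t : ℝ => a + t • d) d t := by
    simpa using ((hasDerivAt_id t).smul_const d).const_add a
  exact (h.hasFDerivAt.comp_hasDerivAt t hl).congr_deriv (by simp)

theorem ConcaveOn.le_add_inner_of_hasGradientAt {f : G → ℝ} {g a : G}
    (hf : ConcaveOn ℝ Set.univ f) (h : HasGradientAt f g a) (b : G) :
    f b ≤ f a + ⟪g, b - a⟫ := by
  have hd : HasDerivAt (fun t : ℝ => f (a + t • (b - a))) ⟪g, b - a⟫ 0 :=
    HasGradientAt.hasDerivAt_comp_line (by simpa using h)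
  have hc : ConcaveOn ℝ Set.univ (fun t : ℝ => f (a + t • (b - a))) := by
    refine ⟨convex_univ, fun s _ t _ u v hu hv huv => ?_⟩
    have := hf.2 (Set.mem_univ (a + s • (b - a))) (Set.mem_univ (a + t • (b - a))) hu hv huv
    convert this using 2
    have : a = (u + v) • a := by rw [huv, one_smul]
    nth_rewrite 1 [this]
    simp only [smul_eq_mul]
    module
  have := hc.slope_le_of_hasDerivAt (Set.mem_univ 0) (Set.mem_univ 1) one_pos hd
  simp [slope] at this
  linarith

theorem Convex.abs_sub_sub_inner_le {f : G → ℝ} {g : G → G} {S : Set G} {ℓ : ℝ} {a b : G}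
    (hS : Convex ℝ S) (hf : ∀ z, HasGradientAt f (g z) z)
    (hg : ∀ z ∈ S, ‖g z - g a‖ ≤ ℓ * ‖z - a‖) (ha : a ∈ S) (hb : b ∈ S) :
    |f b - f a - ⟪g a, b - a⟫| ≤ ℓ / 2 * ‖b - a‖ ^ 2 := by
  have key : ∀ ε : ℝ, |ε| = 1 →
      ε * (f b - f a - ⟪g a, b - a⟫) ≤ ℓ / 2 * ‖b - a‖ ^ 2 := by
    intro ε hε
    have hd : ∀ t : ℝ, HasDerivAt (fun t : ℝ => ε * (f (a + t • (b - a)) - t * ⟪g a, b - a⟫)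
        - ℓ / 2 * t ^ 2 * ‖b - a‖ ^ 2)
        (ε * (⟪g (a + t • (b - a)), b - a⟫ - ⟪g a, b - a⟫) - ℓ * t * ‖b - a‖ ^ 2) t := by
      intro t
      have h1 := (hf (a + t • (b - a))).hasDerivAt_comp_line
      have h2 := ((h1.sub ((hasDerivAt_id t).mul_const ⟪g a, b - a⟫)).const_mul ε).sub
        ((((hasDerivAt_id t).pow 2).const_mul (ℓ / 2)).mul_const (‖b - a‖ ^ 2))
      exact h2.congr_deriv (by simp only [id, one_mul]; push_cast; ring)
    have hanti : AntitoneOn (fun t : ℝ => ε * (f (a + t • (b - a)) - t * ⟪g a, b - a⟫)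
        - ℓ / 2 * t ^ 2 * ‖b - a‖ ^ 2) (Set.Icc 0 1) := by
      refine antitoneOn_of_deriv_nonpos (convex_Icc 0 1)
        (fun t _ => (hd t).continuousAt.continuousWithinAt)
        (fun t _ => (hd t).differentiableAt.differentiableWithinAt) fun t ht => ?_
      rw [interior_Icc] at ht
      rw [(hd t).deriv, ← inner_sub_left]
      have hz : a + t • (b - a) ∈ S :=
        hS.add_smul_sub_mem ha hb ⟨ht.1.le, ht.2.le⟩
      have h1 := hg _ hz
      rw [add_sub_cancel_left, norm_smul, Real.norm_of_nonneg ht.1.le] at h1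
      have h2 : ε * ⟪g (a + t • (b - a)) - g a, b - a⟫
          ≤ ‖g (a + t • (b - a)) - g a‖ * ‖b - a‖ := by
        refine (le_abs_self _).trans ?_
        rw [abs_mul, hε, one_mul]
        exact abs_real_inner_le_norm _ _
      nlinarith [norm_nonneg (b - a)]
    have := hanti (Set.left_mem_Icc.2 zero_le_one) (Set.right_mem_Icc.2 zero_le_one) zero_le_one
    simp only [zero_smul, add_zero, one_smul, add_sub_cancel] at this
    linarith
  refine abs_le.2 ⟨?_, ?_⟩
  · linarith [key (-1) (by simp)]
  · linarith [key 1 (by simp)]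

theorem Convex.abs_sub_le_of_norm_gradient_le {f : G → ℝ} {g : G → G} {S : Set G} {B : ℝ} {a b : G}
    (hS : Convex ℝ S) (hf : ∀ z, HasGradientAt f (g z) z)
    (hg : ∀ z ∈ S, ‖g z‖ ≤ B) (ha : a ∈ S) (hb : b ∈ S) :
    |f b - f a| ≤ B * ‖b - a‖ :=
  hS.norm_image_sub_le_of_norm_hasFDerivWithin_le
    (fun z _ => (hf z).hasFDerivAt.hasFDerivWithinAt) (fun z hz => by simpa using hg z hz) ha hb

/-- Progress of one short Frank-Wolfe step on a strongly convex set. -/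
theorem frankWolfe_progress {S : Set G} {α ℓ σ : ℝ} (hSc : Convex ℝ S)
    (hS : ∀ u ∈ S, ∀ v ∈ S, ∀ γ ∈ Set.Icc (0 : ℝ) 1, ∀ w : G, ‖w‖ = 1 →
      γ • u + (1 - γ) • v + (γ * (1 - γ) * (α / 2) * ‖u - v‖ ^ 2) • w ∈ S)
    {f : G → ℝ} {g : G → G} (hf : ∀ z, HasGradientAt f (g z) z) (hℓ : 0 < ℓ)
    {p y : G} (hp : p ∈ S) (hy : y ∈ S)
    (hg : ∀ z ∈ S, ‖g z - g y‖ ≤ ℓ * ‖z - y‖) (hmax : ∀ z ∈ S, ⟪g y, z⟫ ≤ ⟪g y, p⟫)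
    (hσ0 : 0 ≤ σ) (hσ1 : σ ≤ 1) (hσ : σ ≤ α / (4 * ℓ) * ‖g y‖) :
    f y + σ / 2 * ⟪g y, p - y⟫ ≤ f (σ • p + (1 - σ) • y) := by
  have hmem : σ • p + (1 - σ) • y ∈ S := hSc hp hy hσ0 (by linarith) (by ring)
  have hsub : σ • p + (1 - σ) • y - y = σ • (p - y) := by module
  have h := (abs_le.1 (hSc.abs_sub_sub_inner_le hf hg hy hmem)).1
  rw [hsub, inner_smul_right, norm_smul, Real.norm_of_nonneg hσ0] at h
  have hgap := norm_mul_sq_le_inner_of_stronglyConvex hS hp hy hmax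
  have hσℓ : ℓ * σ ≤ α / 4 * ‖g y‖ := by
    calc ℓ * σ ≤ ℓ * (α / (4 * ℓ) * ‖g y‖) := by gcongr
      _ = α / 4 * ‖g y‖ := by field_simp
  have h2 : σ * (ℓ * σ * ‖p - y‖ ^ 2) ≤ σ * ⟪g y, p - y⟫ := by
    gcongr
    exact (by gcongr : _ ≤ _).trans hgap
  nlinarith

theorem HasGradientAt.tikhonov_sub {f : G → ℝ} {g y : G} (h : HasGradientAt f g y) (μ : ℝ) (c : G) :
    HasGradientAt (tikhonov f μ c) (g - μ • (y - c)) y := by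
  rw [hasGradientAt_iff_hasFDerivAt] at h ⊢
  have h1 : HasFDerivAt (fun y => ‖y - c‖ ^ 2) _ y :=
    ((hasFDerivAt_id y).sub_const c).norm_sq
  have h2 := h.sub (h1.const_mul (μ / 2))
  refine h2.congr_fderiv ?_
  ext v
  simp
  ring

theorem ConcaveOn.tikhonov_le {f : G → ℝ} {g y : G} (hf : ConcaveOn ℝ Set.univ f)
    (h : HasGradientAt f g y) (μ : ℝ) (c z : G) :
    tikhonov f μ c z ≤ tikhonov f μ c y + ⟪g - μ • (y - c), z - y⟫ - μ / 2 * ‖z - y‖ ^ 2 := by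
  have h1 := hf.le_add_inner_of_hasGradientAt h z
  have h2 : ‖z - c‖ ^ 2 = ‖z - y‖ ^ 2 + 2 * ⟪y - c, z - y⟫ + ‖y - c‖ ^ 2 := by
    have : z - c = (y - c) + (z - y) := by abel
    rw [this, norm_add_sq_real]; ring
  rw [inner_sub_left, real_inner_smul_left]
  simp only [tikhonov, h2]
  linarith

end Hilbert

/-- A perturbed sublinear recursion reaches the noise level or decays like `2 / (κ k)`. -/
theorem recursion_bound {a : ℕ → ℝ} {κ b R : ℝ} {K : ℕ} (ha : ∀ k, 0 ≤ a k)
    (hκ : 0 ≤ κ) (hb : 0 ≤ b) (hR : 0 ≤ R) (hRb : 2 * b ≤ κ * R ^ 2)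
    (hrec : ∀ k < K, a (k + 1) ≤ a k - κ * a k ^ 2 + b) :
    ∀ k ≤ K, κ * k * a k ≤ 2 ∨ a k ≤ R + b := by
  intro k
  induction k with
  | zero => intro _; left; simp
  | succ k ih =>
    intro hk
    have hr := hrec k (by omega)
    have hak := ha k
    rcases le_total (a k) R with h | h
    · right
      nlinarith [mul_nonneg hκ (sq_nonneg (a k))]
    · have hsq : κ * R ^ 2 ≤ κ * a k ^ 2 := by gcongr
      rcases ih (by omega) with h1 | h1
      · left
        push_cast
        have hle : a (k + 1) ≤ a k - κ / 2 * a k ^ 2 := by linarith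
        have hk0 : (0 : ℝ) ≤ k := Nat.cast_nonneg k
        have hκk : 0 ≤ κ * (k + 1) := by positivity
        have h2 := mul_le_mul_of_nonneg_left hle hκk
        have h3 : 0 ≤ κ * a k := by positivity
        have h4 : 0 ≤ κ * k * a k := by positivity
        nlinarith [mul_nonneg h3 h4, sq_nonneg (κ * a k)]
      · right
        nlinarith [mul_nonneg hκ (sq_nonneg (a k))]

theorem le_of_sq_le_contraction {a u b σ : ℝ} (ha : 0 ≤ a) (hb : 0 ≤ b) (hσ : σ ≤ 1)
    (h : u ^ 2 ≤ (1 - σ / 2) * a ^ 2 + b * u) : u ≤ (1 - σ / 4) * a + b := by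
  by_contra! hlt
  have hv : 0 ≤ (1 - σ / 4) * a := mul_nonneg (by linarith) ha
  have h1 : (1 - σ / 2) * a ^ 2 ≤ ((1 - σ / 4) * a) ^ 2 := by
    nlinarith [sq_nonneg (σ * a)]
  nlinarith

theorem exists_le_of_telescoping {φ v : ℕ → ℝ} {m K : ℕ} {τ δ ρ : ℝ} (hmK : m < K) (hτ : 0 < τ)
    (hstep : ∀ k, m ≤ k → k < K → τ * v k ≤ φ k - φ (k + 1) + τ * δ)
    (hφ : φ m - φ K ≤ ((K : ℝ) - m) * τ * ρ) :
    ∃ t, m ≤ t ∧ t < K ∧ v t ≤ δ + ρ := by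
  have hsum : ∑ k ∈ Finset.Ico m K, τ * v k ≤ ∑ _k ∈ Finset.Ico m K, τ * (δ + ρ) := by
    calc ∑ k ∈ Finset.Ico m K, τ * v k
        ≤ ∑ k ∈ Finset.Ico m K, (-(φ (k + 1) - φ k) + τ * δ) :=
          Finset.sum_le_sum fun k hk => by
            rw [Finset.mem_Ico] at hk
            linarith [hstep k hk.1 hk.2]
      _ = φ m - φ K + (K - m) * (τ * δ) := by
          rw [Finset.sum_add_distrib, Finset.sum_neg_distrib, Finset.sum_Ico_sub _ hmK.le]
          simp [Nat.cast_sub hmK.le]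
      _ ≤ ∑ _k ∈ Finset.Ico m K, τ * (δ + ρ) := by
          simp only [Finset.sum_const, Nat.card_Ico, nsmul_eq_mul, Nat.cast_sub hmK.le]
          linarith
  obtain ⟨t, ht, hle⟩ := Finset.exists_le_of_sum_le (Finset.nonempty_Ico.2 hmK) hsum
  rw [Finset.mem_Ico] at ht
  exact ⟨t, ht.1, ht.2, le_of_mul_le_mul_left hle hτ⟩

section Iterates

variable {E F : Type*} [NormedAddCommGroup E] [InnerProductSpace ℝ E]
  [NormedAddCommGroup F] [InnerProductSpace ℝ F]

/-- The first `K` steps of R-PDCG with primal step `τ`, regularization `μ` and dual steps `σ`. -/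
structure IsRPDCG (X : Set E) (Y : Set F) (gy : E → F → F) (α Lyy μ τ : ℝ) (K : ℕ)
    (x s : ℕ → E) (y p : ℕ → F) (y₀ : F) (g : ℕ → F) (σ : ℕ → ℝ) : Prop where
  x_zero_mem : x 0 ∈ X
  y_zero_mem : y 0 ∈ Y
  y₀_mem : y₀ ∈ Y
  s_mem : ∀ k < K, s k ∈ X
  p_mem : ∀ k < K, p k ∈ Y
  p_max : ∀ k < K, ∀ z ∈ Y, ⟪g k, z⟫ ≤ ⟪g k, p k⟫
  g_eq : ∀ k, g k = gy (x k) (y k) - μ • (y k - y₀)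
  σ_eq : ∀ k, σ k = min 1 (α / (4 * (Lyy + μ)) * ‖g k‖)
  x_succ : ∀ k < K, x (k + 1) = τ • s k + (1 - τ) • x k
  y_succ : ∀ k < K, y (k + 1) = σ k • p k + (1 - σ k) • y k

namespace IsRPDCG

variable {X : Set E} {Y : Set F} {gy : E → F → F}
  {Lyy α μ τ : ℝ} {K : ℕ} {x s : ℕ → E} {y p : ℕ → F} {y₀ : F} {g : ℕ → F} {σ : ℕ → ℝ}

theorem σ_mem (I : IsRPDCG X Y gy α Lyy μ τ K x s y p y₀ g σ)
    (hα : 0 ≤ α) (hL : 0 ≤ Lyy + μ) (k : ℕ) : 0 ≤ σ k ∧ σ k ≤ 1 := by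
  rw [I.σ_eq]
  exact ⟨le_min zero_le_one (by positivity), min_le_left _ _⟩

theorem mem_X (I : IsRPDCG X Y gy α Lyy μ τ K x s y p y₀ g σ) (hX : Convex ℝ X)
    (hτ0 : 0 ≤ τ) (hτ1 : τ ≤ 1) : ∀ k ≤ K, x k ∈ X := by
  intro k
  induction k with
  | zero => exact fun _ => I.x_zero_mem
  | succ k ih =>
    intro hk
    rw [I.x_succ k hk]
    exact hX (I.s_mem k hk) (ih (by omega)) hτ0 (by linarith) (by ring)

theorem mem_Y (I : IsRPDCG X Y gy α Lyy μ τ K x s y p y₀ g σ) (hY : Convex ℝ Y)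
    (hα : 0 ≤ α) (hL : 0 ≤ Lyy + μ) : ∀ k ≤ K, y k ∈ Y := by
  intro k
  induction k with
  | zero => exact fun _ => I.y_zero_mem
  | succ k ih =>
    intro hk
    have hσ := I.σ_mem hα hL k
    rw [I.y_succ k hk]
    exact hY (I.p_mem k hk) (ih (by omega)) hσ.1 (by linarith) (by ring)

end IsRPDCG

end Iterates

section Saddle

variable {E F : Type*} [NormedAddCommGroup E] [InnerProductSpace ℝ E] [CompleteSpace E]
  [NormedAddCommGroup F] [InnerProductSpace ℝ F] [CompleteSpace F]

/-- A smooth nonconvex-concave saddle problem on bounded sets, with strongly convex dual set,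
together with bounds `D` on the diameters and `Gx`, `Gy` on the partial gradients. -/
structure IsSmoothSaddle (X : Set E) (Y : Set F) (L : E → F → ℝ) (gx : E → F → E) (gy : E → F → F)
    (Lxx Lyx Lyy α D Gx Gy : ℝ) : Prop where
  convex_X : Convex ℝ X
  convex_Y : Convex ℝ Y
  hasGradientAt_x : ∀ x y, HasGradientAt (fun x => L x y) (gx x y) x
  hasGradientAt_y : ∀ x y, HasGradientAt (L x) (gy x y) y
  Lxx_nonneg : 0 ≤ Lxx
  Lyx_nonneg : 0 ≤ Lyx
  Lyy_nonneg : 0 ≤ Lyy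
  lip_x : ∀ x ∈ X, ∀ x' ∈ X, ∀ y ∈ Y, ∀ y' ∈ Y,
    ‖gx x y - gx x' y'‖ ≤ Lxx * ‖x - x'‖ + Lyx * ‖y - y'‖
  lip_y : ∀ x ∈ X, ∀ x' ∈ X, ∀ y ∈ Y, ∀ y' ∈ Y,
    ‖gy x y - gy x' y'‖ ≤ Lyx * ‖x - x'‖ + Lyy * ‖y - y'‖
  concave : ∀ x ∈ X, ConcaveOn ℝ Set.univ (L x)
  α_pos : 0 < α
  stronglyConvex : ∀ u ∈ Y, ∀ v ∈ Y, ∀ γ ∈ Set.Icc (0 : ℝ) 1, ∀ w : F, ‖w‖ = 1 →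
    γ • u + (1 - γ) • v + (γ * (1 - γ) * (α / 2) * ‖u - v‖ ^ 2) • w ∈ Y
  D_pos : 0 < D
  norm_sub_le_x : ∀ x ∈ X, ∀ x' ∈ X, ‖x - x'‖ ≤ D
  norm_sub_le_y : ∀ y ∈ Y, ∀ y' ∈ Y, ‖y - y'‖ ≤ D
  norm_gx_le : ∀ x ∈ X, ∀ y ∈ Y, ‖gx x y‖ ≤ Gx
  norm_gy_le : ∀ x ∈ X, ∀ y ∈ Y, ‖gy x y‖ ≤ Gy

namespace IsSmoothSaddle

variable {X : Set E} {Y : Set F} {L : E → F → ℝ} {gx : E → F → E} {gy : E → F → F}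
  {Lxx Lyx Lyy α D Gx Gy : ℝ}

theorem abs_cross_sub_le (H : IsSmoothSaddle X Y L gx gy Lxx Lyx Lyy α D Gx Gy)
    {x x' : E} {y y' : F} (hx : x ∈ X) (hx' : x' ∈ X) (hy : y ∈ Y) (hy' : y' ∈ Y) :
    |(L x' y' - L x' y) - (L x y' - L x y)| ≤ Lyx * ‖y' - y‖ * ‖x' - x‖ := by
  refine H.convex_X.abs_sub_le_of_norm_gradient_le (f := fun x => L x y' - L x y)
    (g := fun x => gx x y' - gx x y) (fun z => ?_) (fun z hz => ?_) hx hx'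
  · rw [hasGradientAt_iff_hasFDerivAt, map_sub]
    exact (H.hasGradientAt_x z y').hasFDerivAt.sub (H.hasGradientAt_x z y).hasFDerivAt
  · simpa using H.lip_x z hz z hz y' hy' y hy

theorem norm_maximizer_sub_le (H : IsSmoothSaddle X Y L gx gy Lxx Lyx Lyy α D Gx Gy) {μ : ℝ}
    {x x' : E} {z z' c : F} (hx : x ∈ X) (hx' : x' ∈ X) (hz : z ∈ Y) (hz' : z' ∈ Y)
    (hmax : ∀ u ∈ Y, tikhonov (L x) μ c u ≤ tikhonov (L x) μ c z)
    (hmax' : ∀ u ∈ Y, tikhonov (L x') μ c u ≤ tikhonov (L x') μ c z') :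
    μ * ‖z' - z‖ ≤ 2 * Lyx * ‖x' - x‖ := by
  rcases eq_or_ne z' z with rfl | hne
  · have := H.Lyx_nonneg
    simp only [sub_self, norm_zero, mul_zero]
    positivity
  have h1 := (H.concave x hx).tikhonov_growth H.convex_Y hz hz' hmax
  have h2 := (H.concave x' hx').tikhonov_growth H.convex_Y hz' hz hmax'
  have h3 := (abs_le.1 (H.abs_cross_sub_le hx hx' hz hz')).2
  rw [norm_sub_rev] at h1
  have hpos : 0 < ‖z' - z‖ := norm_pos_iff.2 (sub_ne_zero.2 hne)
  simp only [tikhonov] at h1 h2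
  refine le_of_mul_le_mul_right ?_ hpos
  nlinarith

end IsSmoothSaddle

namespace IsRPDCG

variable {X : Set E} {Y : Set F} {L : E → F → ℝ} {gx : E → F → E} {gy : E → F → F}
  {Lxx Lyx Lyy α D Gx Gy μ τ ν cg : ℝ} {K : ℕ} {x s : ℕ → E} {y p : ℕ → F} {y₀ : F}
  {g : ℕ → F} {σ : ℕ → ℝ} {z : ℕ → F}

theorem norm_x_succ_sub_le (I : IsRPDCG X Y gy α Lyy μ τ K x s y p y₀ g σ)
    (H : IsSmoothSaddle X Y L gx gy Lxx Lyx Lyy α D Gx Gy) (hτ0 : 0 ≤ τ) (hτ1 : τ ≤ 1)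
    {k : ℕ} (hk : k < K) : ‖x (k + 1) - x k‖ ≤ τ * D := by
  have : x (k + 1) - x k = τ • (s k - x k) := by rw [I.x_succ k hk]; module
  rw [this, norm_smul, Real.norm_of_nonneg hτ0]
  gcongr
  exact H.norm_sub_le_x _ (I.s_mem k hk) _ (I.mem_X H.convex_X hτ0 hτ1 k hk.le)

theorem mul_norm_le_σ (I : IsRPDCG X Y gy α Lyy μ τ K x s y p y₀ g σ)
    (H : IsSmoothSaddle X Y L gx gy Lxx Lyx Lyy α D Gx Gy) (hμ0 : 0 < μ) (hμ1 : μ ≤ 1)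
    (hcg0 : 0 ≤ cg) (hcg : cg ≤ α / (4 * (Lyy + 1))) (hcg1 : cg * (Gy + D) ≤ 1)
    (hτ0 : 0 ≤ τ) (hτ1 : τ ≤ 1) {k : ℕ} (hk : k ≤ K) : cg * ‖g k‖ ≤ σ k := by
  have hα := H.α_pos
  have hLyy := H.Lyy_nonneg
  have hx := I.mem_X H.convex_X hτ0 hτ1 k hk
  have hy := I.mem_Y H.convex_Y hα.le (by positivity) k hk
  rw [I.σ_eq]
  refine le_min ?_ ?_
  · refine le_trans ?_ hcg1
    gcongr
    rw [I.g_eq]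
    refine (norm_sub_le _ _).trans ?_
    refine add_le_add (H.norm_gy_le _ hx _ hy) ?_
    rw [norm_smul, Real.norm_of_nonneg hμ0.le]
    have := H.norm_sub_le_y _ hy _ I.y₀_mem
    nlinarith [norm_nonneg (y k - y₀)]
  · gcongr
    exact hcg.trans (by gcongr)

theorem dual_progress (I : IsRPDCG X Y gy α Lyy μ τ K x s y p y₀ g σ)
    (H : IsSmoothSaddle X Y L gx gy Lxx Lyx Lyy α D Gx Gy) (hμ0 : 0 < μ)
    (hτ0 : 0 ≤ τ) (hτ1 : τ ≤ 1) {k : ℕ} (hk : k < K) :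
    tikhonov (L (x k)) μ y₀ (y k) + σ k / 2 * ⟪g k, p k - y k⟫
      ≤ tikhonov (L (x k)) μ y₀ (y (k + 1)) := by
  have hα := H.α_pos
  have hLyy := H.Lyy_nonneg
  have hx := I.mem_X H.convex_X hτ0 hτ1 k hk.le
  have hy := I.mem_Y H.convex_Y hα.le (by positivity) k hk.le
  have hσ := I.σ_mem hα.le (by positivity) k
  rw [I.y_succ k hk, I.g_eq]
  refine frankWolfe_progress (α := α) (ℓ := Lyy + μ) H.convex_Y H.stronglyConvex
    (g := fun v => gy (x k) v - μ • (v - y₀))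
    (fun v => (H.hasGradientAt_y (x k) v).tikhonov_sub μ y₀) (by positivity)
    (I.p_mem k hk) hy (fun v hv => ?_) ?_ hσ.1 hσ.2 ?_
  · have h1 := H.lip_y _ hx _ hx v hv _ hy
    have h2 : gy (x k) v - μ • (v - y₀) - (gy (x k) (y k) - μ • (y k - y₀))
        = (gy (x k) v - gy (x k) (y k)) - μ • (v - y k) := by module
    rw [h2]
    refine (norm_sub_le _ _).trans ?_
    rw [norm_smul, Real.norm_of_nonneg hμ0.le]
    simp only [sub_self, norm_zero, mul_zero, zero_add] at h1
    linarith
  · simpa only [← I.g_eq] using I.p_max k hk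
  · rw [← I.g_eq, I.σ_eq]
    exact min_le_right _ _

/-- The regularized dual gap at the `k`-th iterate, `z k` being a maximizer at `x k`. -/
noncomputable def dualGap (L : E → F → ℝ) (μ : ℝ) (y₀ : F) (x : ℕ → E) (y z : ℕ → F) (k : ℕ) : ℝ :=
  tikhonov (L (x k)) μ y₀ (z k) - tikhonov (L (x k)) μ y₀ (y k)

theorem mul_sqrt_dualGap_le_norm (H : IsSmoothSaddle X Y L gx gy Lxx Lyx Lyy α D Gx Gy)
    (I : IsRPDCG X Y gy α Lyy (ν ^ 2) τ K x s y p y₀ g σ) (hν : 0 < ν)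
    {k : ℕ} (hx : x k ∈ X) : ν * √(dualGap L (ν ^ 2) y₀ x y z k) ≤ ‖g k‖ := by
  have h := (H.concave _ hx).tikhonov_le (H.hasGradientAt_y (x k) (y k)) (ν ^ 2) y₀ (z k)
  rw [← I.g_eq] at h
  have h1 := real_inner_le_norm (g k) (z k - y k)
  have h2 : ν ^ 2 * dualGap L (ν ^ 2) y₀ x y z k ≤ ‖g k‖ ^ 2 := by
    unfold dualGap
    nlinarith [sq_nonneg (‖g k‖ - ν ^ 2 * ‖z k - y k‖), sq_nonneg ‖g k‖,
      mul_le_mul_of_nonneg_left (h.trans (by gcongr :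
        _ ≤ tikhonov (L (x k)) (ν ^ 2) y₀ (y k) + ‖g k‖ * ‖z k - y k‖
          - ν ^ 2 / 2 * ‖z k - y k‖ ^ 2)) (sq_nonneg ν)]
  rw [← Real.sqrt_sq hν.le, ← Real.sqrt_mul (sq_nonneg ν), ← Real.sqrt_sq (norm_nonneg (g k))]
  exact Real.sqrt_le_sqrt (by rwa [Real.sqrt_sq hν.le])

theorem dualGap_le_inner (H : IsSmoothSaddle X Y L gx gy Lxx Lyx Lyy α D Gx Gy)
    (I : IsRPDCG X Y gy α Lyy μ τ K x s y p y₀ g σ) (hμ : 0 ≤ μ)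
    {k : ℕ} (hk : k < K) (hx : x k ∈ X) (hz : z k ∈ Y) :
    dualGap L μ y₀ x y z k ≤ ⟪g k, p k - y k⟫ := by
  have h := (H.concave _ hx).tikhonov_le (H.hasGradientAt_y (x k) (y k)) μ y₀ (z k)
  rw [← I.g_eq] at h
  have h1 := I.p_max k hk _ hz
  rw [inner_sub_right] at h ⊢
  unfold dualGap
  have : 0 ≤ μ / 2 * ‖z k - y k‖ ^ 2 := by positivity
  linarith

theorem mul_norm_maximizer_sub_le (H : IsSmoothSaddle X Y L gx gy Lxx Lyx Lyy α D Gx Gy)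
    {k : ℕ} (hx : x k ∈ X) (hy : y k ∈ Y) (hz : z k ∈ Y)
    (hmax : ∀ u ∈ Y, tikhonov (L (x k)) (ν ^ 2) y₀ u ≤ tikhonov (L (x k)) (ν ^ 2) y₀ (z k)) :
    ν * ‖z k - y k‖ ≤ 2 * √(dualGap L (ν ^ 2) y₀ x y z k) := by
  have h := (H.concave _ hx).tikhonov_growth H.convex_Y hz hy hmax
  have h0 : 0 ≤ dualGap L (ν ^ 2) y₀ x y z k := sub_nonneg.2 (hmax _ hy)
  refine le_of_sq_le_sq ?_ (by positivity)
  rw [mul_pow, mul_pow, Real.sq_sqrt h0]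
  unfold dualGap
  linarith

theorem sqrt_dualGap_succ_le (I : IsRPDCG X Y gy α Lyy (ν ^ 2) τ K x s y p y₀ g σ)
    (H : IsSmoothSaddle X Y L gx gy Lxx Lyx Lyy α D Gx Gy) (hν0 : 0 < ν) (hν1 : ν ≤ 1)
    (hcg0 : 0 ≤ cg) (hcg : cg ≤ α / (4 * (Lyy + 1))) (hcg1 : cg * (Gy + D) ≤ 1)
    (hτ0 : 0 ≤ τ) (hτ1 : τ ≤ 1) (hz : ∀ k ≤ K, z k ∈ Y)
    (hmax : ∀ k ≤ K, ∀ u ∈ Y,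
      tikhonov (L (x k)) (ν ^ 2) y₀ u ≤ tikhonov (L (x k)) (ν ^ 2) y₀ (z k))
    {k : ℕ} (hk : k < K) :
    √(dualGap L (ν ^ 2) y₀ x y z (k + 1)) ≤ √(dualGap L (ν ^ 2) y₀ x y z k)
      - cg * ν / 4 * √(dualGap L (ν ^ 2) y₀ x y z k) ^ 2 + 2 * Lyx * D * τ / ν := by
  have hα := H.α_pos
  have hLyy := H.Lyy_nonneg
  have hLyx := H.Lyx_nonneg
  have hD := H.D_pos
  have hμ0 : 0 < ν ^ 2 := by positivity
  have hx := I.mem_X H.convex_X hτ0 hτ1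
  have hy := I.mem_Y H.convex_Y hα.le (by positivity)
  have hσ := I.σ_mem hα.le (by positivity) k
  have hgap0 : ∀ k ≤ K, 0 ≤ dualGap L (ν ^ 2) y₀ x y z k :=
    fun k hk => sub_nonneg.2 (hmax k hk _ (hy k hk))
  set a := √(dualGap L (ν ^ 2) y₀ x y z k)
  set u := √(dualGap L (ν ^ 2) y₀ x y z (k + 1))
  have ha2 : a ^ 2 = dualGap L (ν ^ 2) y₀ x y z k := Real.sq_sqrt (hgap0 k hk.le)
  have hu2 : u ^ 2 = dualGap L (ν ^ 2) y₀ x y z (k + 1) := Real.sq_sqrt (hgap0 (k + 1) hk)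
  have hstep : u ^ 2 ≤ (1 - σ k / 2) * a ^ 2 + 2 * Lyx * D * τ / ν * u := by
    have h1 := I.dual_progress H hμ0 hτ0 hτ1 hk
    have h2 := dualGap_le_inner H I hμ0.le hk (hx k hk.le) (hz k hk.le)
    have h3 : σ k / 2 * a ^ 2 ≤ σ k / 2 * ⟪g k, p k - y k⟫ := by
      rw [ha2]; gcongr; linarith
    have h4 := (abs_le.1 (H.abs_cross_sub_le (hx k hk.le) (hx (k + 1) hk)
      (hy (k + 1) hk) (hz (k + 1) hk))).2
    have h5 := mul_norm_maximizer_sub_le H (hx (k + 1) hk) (hy (k + 1) hk) (hz (k + 1) hk)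
      (hmax (k + 1) hk)
    have h6 : Lyx * ‖z (k + 1) - y (k + 1)‖ * ‖x (k + 1) - x k‖
        ≤ 2 * Lyx * D * τ / ν * u := by
      have h7 : ‖z (k + 1) - y (k + 1)‖ ≤ 2 * u / ν := by
        rw [le_div_iff₀ hν0]; linarith
      calc Lyx * ‖z (k + 1) - y (k + 1)‖ * ‖x (k + 1) - x k‖
          ≤ Lyx * (2 * u / ν) * (τ * D) := by
            gcongr
            exact I.norm_x_succ_sub_le H hτ0 hτ1 hk
        _ = _ := by ring
    have h8 := hmax k hk.le _ (hz (k + 1) hk)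
    rw [sub_mul, one_mul]
    rw [ha2] at h3 ⊢
    rw [hu2]
    simp only [dualGap, tikhonov] at *
    linarith
  have h := le_of_sq_le_contraction (Real.sqrt_nonneg _) (by positivity)
    hσ.2 hstep
  have hσa : cg * ν * a ≤ σ k := by
    have h1 := mul_sqrt_dualGap_le_norm (z := z) H I hν0 (hx k hk.le)
    have h2 := I.mul_norm_le_σ H hμ0 (pow_le_one₀ hν0.le hν1) hcg0 hcg hcg1 hτ0 hτ1 hk.le
    calc cg * ν * a = cg * (ν * a) := by ring
      _ ≤ cg * ‖g k‖ := by gcongr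
      _ ≤ σ k := h2
  have h9 := mul_le_mul_of_nonneg_right hσa (Real.sqrt_nonneg _ : 0 ≤ a)
  linarith

/-- In the second half of the run the regularized dual gap is of order `ν ^ 8 = K ^ (-2/3)`. -/
theorem sqrt_dualGap_le (I : IsRPDCG X Y gy α Lyy (ν ^ 2) (ν ^ 10) K x s y p y₀ g σ)
    (H : IsSmoothSaddle X Y L gx gy Lxx Lyx Lyy α D Gx Gy) (hν0 : 0 < ν) (hν1 : ν ≤ 1)
    (hK : ν ^ 12 * K = 1)
    (hcg0 : 0 < cg) (hcg : cg ≤ α / (4 * (Lyy + 1))) (hcg1 : cg * (Gy + D) ≤ 1)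
    (hz : ∀ k ≤ K, z k ∈ Y)
    (hmax : ∀ k ≤ K, ∀ u ∈ Y,
      tikhonov (L (x k)) (ν ^ 2) y₀ u ≤ tikhonov (L (x k)) (ν ^ 2) y₀ (z k))
    {k : ℕ} (hk : k ≤ K) (hkK : K ≤ 2 * k) :
    √(dualGap L (ν ^ 2) y₀ x y z k)
      ≤ (1 + 16 * Lyx * D / cg + 2 * Lyx * D + 16 / cg) * ν ^ 4 := by
  have hLyx := H.Lyx_nonneg
  have hD := H.D_pos
  set ρ := 1 + 16 * Lyx * D / cg with hρ
  have hq : 0 ≤ 16 * Lyx * D / cg := by positivity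
  have hρ1 : 1 ≤ ρ := by linarith
  have hcρ : 16 * Lyx * D ≤ cg * ρ ^ 2 := by
    have : cg * ρ = cg + 16 * Lyx * D := by rw [hρ]; field_simp
    nlinarith [mul_nonneg (mul_nonneg hcg0.le (by linarith : 0 ≤ ρ)) (sub_nonneg.2 hρ1)]
  have hb : 2 * Lyx * D * ν ^ 10 / ν = 2 * Lyx * D * ν ^ 9 := by field_simp
  have hrec := recursion_bound (a := fun k => √(dualGap L (ν ^ 2) y₀ x y z k))
    (κ := cg * ν / 4) (b := 2 * Lyx * D * ν ^ 10 / ν) (R := ρ * ν ^ 4) (K := K)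
    (fun _ => Real.sqrt_nonneg _) (by positivity) (by positivity) (by positivity)
    (by
      rw [hb]
      have := mul_le_mul_of_nonneg_right hcρ (by positivity : 0 ≤ ν ^ 9 / 4)
      linarith)
    (fun k hk => I.sqrt_dualGap_succ_le H hν0 hν1 hcg0.le hcg hcg1 (by positivity)
      (pow_le_one₀ hν0.le hν1) hz hmax hk) k hk
  have h94 : ν ^ 9 ≤ ν ^ 4 := pow_le_pow_of_le_one hν0.le hν1 (by norm_num)
  have h114 : ν ^ 11 ≤ ν ^ 4 := pow_le_pow_of_le_one hν0.le hν1 (by norm_num)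
  set a := √(dualGap L (ν ^ 2) y₀ x y z k)
  have ha0 : 0 ≤ a := Real.sqrt_nonneg _
  have h4 : 0 ≤ ν ^ 4 := by positivity
  rw [hb] at hrec
  have hLD : 2 * Lyx * D * ν ^ 9 ≤ 2 * Lyx * D * ν ^ 4 := by gcongr
  have hc4 : 16 / cg * ν ^ 11 ≤ 16 / cg * ν ^ 4 := by gcongr
  rcases hrec with h | h
  · have hkK' : (K : ℝ) ≤ 2 * k := by exact_mod_cast hkK
    have h1 : cg * ν * a * K ≤ 16 := by
      have := mul_le_mul_of_nonneg_left hkK' (by positivity : 0 ≤ cg * ν * a)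
      linarith
    have h2 : cg * ν * a ≤ 16 * ν ^ 12 := by
      have := mul_le_mul_of_nonneg_right h1 (by positivity : 0 ≤ ν ^ 12)
      calc cg * ν * a = cg * ν * a * (ν ^ 12 * K) := by rw [hK, mul_one]
        _ ≤ _ := by linarith
    have h3 : a ≤ 16 / cg * ν ^ 11 := by
      refine le_of_mul_le_mul_left ?_ (mul_pos hcg0 hν0)
      calc cg * ν * a ≤ 16 * ν ^ 12 := h2
        _ = cg * ν * (16 / cg * ν ^ 11) := by field_simp
    have : 0 ≤ (ρ + 2 * Lyx * D) * ν ^ 4 := by positivity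
    linarith
  · have : 0 ≤ 16 / cg * ν ^ 4 := by positivity
    linarith

theorem inner_gap_le (I : IsRPDCG X Y gy α Lyy (ν ^ 2) τ K x s y p y₀ g σ)
    (H : IsSmoothSaddle X Y L gx gy Lxx Lyx Lyy α D Gx Gy) (hν0 : 0 < ν) (hν1 : ν ≤ 1)
    (hcg0 : 0 < cg) (hcg : cg ≤ α / (4 * (Lyy + 1))) (hcg1 : cg * (Gy + D) ≤ 1)
    (hτ0 : 0 ≤ τ) (hτ1 : τ ≤ 1)
    {k : ℕ} (hk : k < K)
    (hmax : ∀ u ∈ Y, tikhonov (L (x k)) (ν ^ 2) y₀ u ≤ tikhonov (L (x k)) (ν ^ 2) y₀ (z k))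
    {B : ℝ} (hB : √(dualGap L (ν ^ 2) y₀ x y z k) ≤ B * ν ^ 4) :
    ⟪g k, p k - y k⟫ ≤ (1 + 2 * D * B ^ 2 / cg) * ν ^ 2 := by
  have hα := H.α_pos
  have hLyy := H.Lyy_nonneg
  have hD := H.D_pos
  have hμ0 : 0 < ν ^ 2 := by positivity
  have hy := I.mem_Y H.convex_Y hα.le (by positivity)
  have hσ := I.σ_mem hα.le (by positivity) k
  have h1 := I.dual_progress H hμ0 hτ0 hτ1 hk
  have h2 := hmax _ (hy (k + 1) hk)
  have h3 : dualGap L (ν ^ 2) y₀ x y z k ≤ (B * ν ^ 4) ^ 2 :=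
    (Real.sqrt_le_left (le_trans (Real.sqrt_nonneg _) hB)).1 hB
  have h4 : σ k * ⟪g k, p k - y k⟫ ≤ 2 * (B * ν ^ 4) ^ 2 := by
    unfold dualGap at h3
    linarith
  set v := ⟪g k, p k - y k⟫ with hv
  have hv0 : 0 ≤ v := by
    have := I.p_max k hk _ (hy k hk.le)
    rw [hv, inner_sub_right]
    linarith
  have hvn : cg * v ≤ σ k * D := by
    calc cg * v ≤ cg * (‖g k‖ * ‖p k - y k‖) := by
          gcongr
          exact real_inner_le_norm _ _
      _ = cg * ‖g k‖ * ‖p k - y k‖ := by ring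
      _ ≤ σ k * D := by
          gcongr
          · exact hσ.1
          · exact I.mul_norm_le_σ H hμ0 (pow_le_one₀ hν0.le hν1) hcg0.le hcg hcg1 hτ0 hτ1 hk.le
          · exact H.norm_sub_le_y _ (I.p_mem k hk) _ (hy k hk.le)
  have h84 : ν ^ 8 ≤ ν ^ 4 := pow_le_pow_of_le_one hν0.le hν1 (by norm_num)
  set c := 1 + 2 * D * B ^ 2 / cg with hc
  have hq : 0 ≤ 2 * D * B ^ 2 / cg := by positivity
  have hc1 : 1 ≤ c := by linarith
  refine le_of_sq_le_sq ?_ (by positivity)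
  refine le_of_mul_le_mul_left ?_ hcg0
  calc cg * v ^ 2 = cg * v * v := by ring
    _ ≤ σ k * D * v := by gcongr
    _ = D * (σ k * v) := by ring
    _ ≤ D * (2 * (B * ν ^ 4) ^ 2) := by gcongr
    _ = 2 * D * B ^ 2 * ν ^ 8 := by ring
    _ ≤ 2 * D * B ^ 2 * ν ^ 4 := by gcongr
    _ = cg * (2 * D * B ^ 2 / cg) * ν ^ 4 := by field_simp
    _ ≤ cg * (c * c) * ν ^ 4 := by gcongr; nlinarith
    _ = cg * (c * ν ^ 2) ^ 2 := by ring

theorem primal_progress (I : IsRPDCG X Y gy α Lyy (ν ^ 2) (ν ^ 10) K x s y p y₀ g σ)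
    (H : IsSmoothSaddle X Y L gx gy Lxx Lyx Lyy α D Gx Gy) (hν0 : 0 < ν) (hν1 : ν ≤ 1)
    (hz : ∀ k ≤ K, z k ∈ Y)
    (hmax : ∀ k ≤ K, ∀ u ∈ Y,
      tikhonov (L (x k)) (ν ^ 2) y₀ u ≤ tikhonov (L (x k)) (ν ^ 2) y₀ (z k))
    {k : ℕ} (hk : k < K)
    {B : ℝ} (hB : √(dualGap L (ν ^ 2) y₀ x y z k) ≤ B * ν ^ 4) :
    ν ^ 10 * ⟪gx (x k) (y k), x k - s k⟫
      ≤ tikhonov (L (x k)) (ν ^ 2) y₀ (z k) - tikhonov (L (x (k + 1))) (ν ^ 2) y₀ (z (k + 1))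
        + ν ^ 10 * ((Lyx * D * (2 * B + 2 * Lyx * D) + Lxx / 2 * D ^ 2) * ν ^ 2) := by
  have hLxx := H.Lxx_nonneg
  have hLyx := H.Lyx_nonneg
  have hLyy := H.Lyy_nonneg
  have hD := H.D_pos
  have hτ0 : 0 < ν ^ 10 := by positivity
  have hτ1 : ν ^ 10 ≤ 1 := pow_le_one₀ hν0.le hν1
  have hx := I.mem_X H.convex_X hτ0.le hτ1
  have hy := I.mem_Y H.convex_Y H.α_pos.le (by positivity)
  have hB0 : 0 ≤ B := by
    have := (Real.sqrt_nonneg _).trans hB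
    exact nonneg_of_mul_nonneg_left this (by positivity)
  have hmove := I.norm_x_succ_sub_le H hτ0.le hτ1 hk
  have hdz : ‖z (k + 1) - z k‖ ≤ 2 * Lyx * D * ν ^ 2 := by
    have h1 := H.norm_maximizer_sub_le (hx k hk.le) (hx (k + 1) hk) (hz k hk.le) (hz (k + 1) hk)
      (hmax k hk.le) (hmax (k + 1) hk)
    have h2 : ν ^ 2 * ‖z (k + 1) - z k‖ ≤ ν ^ 2 * (2 * Lyx * D * ν ^ 8) := by
      calc ν ^ 2 * ‖z (k + 1) - z k‖ ≤ 2 * Lyx * ‖x (k + 1) - x k‖ := h1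
        _ ≤ 2 * Lyx * (ν ^ 10 * D) := by gcongr
        _ = _ := by ring
    refine (le_of_mul_le_mul_left h2 (by positivity)).trans ?_
    gcongr 2 * Lyx * D * ?_
    exact pow_le_pow_of_le_one hν0.le hν1 (by norm_num)
  have hzy : ‖z k - y k‖ ≤ 2 * B * ν ^ 2 := by
    have h1 := mul_norm_maximizer_sub_le H (hx k hk.le) (hy k hk.le) (hz k hk.le) (hmax k hk.le)
    have h2 : ν * ‖z k - y k‖ ≤ ν * (2 * B * ν ^ 3) := by linarith
    refine (le_of_mul_le_mul_left h2 hν0).trans ?_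
    gcongr 2 * B * ?_
    exact pow_le_pow_of_le_one hν0.le hν1 (by norm_num)
  have hdesc := (abs_le.1 (H.convex_X.abs_sub_sub_inner_le
    (f := fun u => L u (z (k + 1))) (g := fun u => gx u (z (k + 1))) (ℓ := Lxx)
    (fun u => H.hasGradientAt_x u _)
    (fun u hu => by simpa using H.lip_x u hu _ (hx k hk.le) _ (hz (k + 1) hk) _ (hz (k + 1) hk))
    (hx k hk.le) (hx (k + 1) hk))).2
  have hsub : x (k + 1) - x k = ν ^ 10 • (s k - x k) := by rw [I.x_succ k hk]; module
  have hsq : Lxx / 2 * ‖x (k + 1) - x k‖ ^ 2 ≤ ν ^ 10 * (Lxx / 2 * D ^ 2 * ν ^ 2) := by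
    calc Lxx / 2 * ‖x (k + 1) - x k‖ ^ 2 ≤ Lxx / 2 * (ν ^ 10 * D) ^ 2 := by gcongr
      _ = ν ^ 10 * (Lxx / 2 * D ^ 2 * ν ^ 10) := by ring
      _ ≤ _ := by
        gcongr ν ^ 10 * (Lxx / 2 * D ^ 2 * ?_)
        exact pow_le_pow_of_le_one hν0.le hν1 (by norm_num)
  have herr : ⟪gx (x k) (z (k + 1)), s k - x k⟫ ≤ -⟪gx (x k) (y k), x k - s k⟫
      + Lyx * D * (2 * B + 2 * Lyx * D) * ν ^ 2 := by
    have h1 : ⟪gx (x k) (z (k + 1)), s k - x k⟫ = -⟪gx (x k) (y k), x k - s k⟫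
        + ⟪gx (x k) (z (k + 1)) - gx (x k) (y k), s k - x k⟫ := by
      rw [inner_sub_left, ← inner_neg_right, neg_sub]; ring
    rw [h1]
    gcongr
    refine (real_inner_le_norm _ _).trans ?_
    have h2 := H.lip_x _ (hx k hk.le) _ (hx k hk.le) _ (hz (k + 1) hk) _ (hy k hk.le)
    simp only [sub_self, norm_zero, mul_zero, zero_add] at h2
    have h3 : ‖z (k + 1) - y k‖ ≤ 2 * Lyx * D * ν ^ 2 + 2 * B * ν ^ 2 :=
      (norm_sub_le_norm_sub_add_norm_sub _ (z k) _).trans <| add_le_add hdz hzy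
    calc _ ≤ Lyx * (2 * Lyx * D * ν ^ 2 + 2 * B * ν ^ 2) * D := by
          gcongr
          · exact h2.trans (by gcongr)
          · exact H.norm_sub_le_x _ (I.s_mem k hk) _ (hx k hk.le)
      _ = _ := by ring
  have hopt := hmax k hk.le _ (hz (k + 1) hk)
  have herr' := mul_le_mul_of_nonneg_left herr hτ0.le
  rw [hsub, inner_smul_right, ← hsub] at hdesc
  simp only [tikhonov] at hopt ⊢
  linarith

/-- R-PDCG reaches primal and regularized dual gaps of order `ν ^ 2 = K ^ (-1/6)`. -/
theorem exists_gap_le (I : IsRPDCG X Y gy α Lyy (ν ^ 2) (ν ^ 10) K x s y p y₀ g σ)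
    (H : IsSmoothSaddle X Y L gx gy Lxx Lyx Lyy α D Gx Gy) (hν0 : 0 < ν) (hν1 : ν ≤ 1)
    (hK2 : 2 ≤ K) (hK : ν ^ 12 * K = 1)
    (hcg0 : 0 < cg) (hcg : cg ≤ α / (4 * (Lyy + 1))) (hcg1 : cg * (Gy + D) ≤ 1)
    (hz : ∀ k ≤ K, z k ∈ Y)
    (hmax : ∀ k ≤ K, ∀ u ∈ Y,
      tikhonov (L (x k)) (ν ^ 2) y₀ u ≤ tikhonov (L (x k)) (ν ^ 2) y₀ (z k))
    {B : ℝ} (hB : 1 + 16 * Lyx * D / cg + 2 * Lyx * D + 16 / cg ≤ B) :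
    ∃ t, (K + 1) / 2 ≤ t ∧ t < K ∧ x t ∈ X ∧ y t ∈ Y ∧
      ⟪gx (x t) (y t), x t - s t⟫ + ⟪g t, p t - y t⟫
        ≤ ((Lyx * D * (2 * B + 2 * Lyx * D) + Lxx / 2 * D ^ 2) + 3 * Gx * D
          + (1 + 2 * D * B ^ 2 / cg)) * ν ^ 2 := by
  have hLyy := H.Lyy_nonneg
  have hD := H.D_pos
  have hτ0 : 0 < ν ^ 10 := by positivity
  have hτ1 : ν ^ 10 ≤ 1 := pow_le_one₀ hν0.le hν1
  have hx := I.mem_X H.convex_X hτ0.le hτ1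
  have hy := I.mem_Y H.convex_Y H.α_pos.le (by positivity)
  have ha : ∀ k, (K + 1) / 2 ≤ k → k < K → √(dualGap L (ν ^ 2) y₀ x y z k) ≤ B * ν ^ 4 :=
    fun k hmk hk => (I.sqrt_dualGap_le H hν0 hν1 hK hcg0 hcg hcg1 hz hmax hk.le
      (by omega)).trans (by gcongr)
  have hmK : (K + 1) / 2 < K := by omega
  have hGx : 0 ≤ Gx := (norm_nonneg _).trans (H.norm_gx_le _ I.x_zero_mem _ I.y_zero_mem)
  obtain ⟨t, hmt, htK, ht⟩ := exists_le_of_telescoping (ρ := 3 * Gx * D * ν ^ 2) hmK hτ0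
    (fun k hmk hk => I.primal_progress H hν0 hν1 hz hmax hk (ha k hmk hk)) (by
      have h1 := hmax K le_rfl _ (hz _ hmK.le)
      have h2 := (abs_le.1 (H.convex_X.abs_sub_le_of_norm_gradient_le
        (f := fun u => L u (z ((K + 1) / 2))) (fun u => H.hasGradientAt_x u _)
        (fun u hu => H.norm_gx_le u hu _ (hz _ hmK.le)) (hx K le_rfl) (hx _ hmK.le))).2
      have h3 : Gx * ‖x ((K + 1) / 2) - x K‖ ≤ Gx * D := by
        gcongr
        exact H.norm_sub_le_x _ (hx _ hmK.le) _ (hx K le_rfl)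
      have h4 : (K : ℝ) ≤ 3 * ((K : ℝ) - ((K + 1) / 2 : ℕ)) := by
        have : 3 * ((K + 1) / 2) ≤ 2 * K := by omega
        have : (3 : ℝ) * ((K + 1) / 2 : ℕ) ≤ 2 * K := by exact_mod_cast this
        linarith
      calc _ ≤ Gx * D := by simp only [tikhonov] at h1 ⊢; linarith
        _ = Gx * D * ν ^ 12 * K := by rw [mul_assoc _ _ (K : ℝ), hK, mul_one]
        _ ≤ Gx * D * ν ^ 12 * (3 * ((K : ℝ) - ((K + 1) / 2 : ℕ))) := by gcongr
        _ = _ := by ring)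
  refine ⟨t, hmt, htK, hx t htK.le, hy t htK.le, ?_⟩
  have hgap := I.inner_gap_le H hν0 hν1 hcg0 hcg hcg1 hτ0.le hτ1 htK (hmax t htK.le)
    (ha t hmt htK)
  linarith

end IsRPDCG

end Saddle

theorem exists_pow_of_natCast {K : ℕ} (hK : 1 ≤ K) : ∃ ν : ℝ, 0 < ν ∧ ν ≤ 1 ∧ ν ^ 12 * K = 1 ∧
    (K : ℝ) ^ (-(1 : ℝ) / 6) = ν ^ 2 ∧ (K : ℝ) ^ (-(5 : ℝ) / 6) = ν ^ 10 := by
  have hK1 : (1 : ℝ) ≤ K := by exact_mod_cast hK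
  have hK0 : (0 : ℝ) < K := by linarith
  refine ⟨(K : ℝ) ^ (-(1 : ℝ) / 12), by positivity,
    Real.rpow_le_one_of_one_le_of_nonpos hK1 (by norm_num), ?_, ?_, ?_⟩
  · rw [← Real.rpow_natCast, ← Real.rpow_mul hK0.le]
    norm_num
    rw [Real.rpow_neg_one, inv_mul_cancel₀ hK0.ne']
  all_goals
    rw [← Real.rpow_natCast, ← Real.rpow_mul hK0.le]
    norm_num

theorem IsCompact.exists_pos_norm_sub_le {G : Type*} [NormedAddCommGroup G] {S : Set G}
    (hS : IsCompact S) : ∃ D, 0 < D ∧ ∀ u ∈ S, ∀ v ∈ S, ‖u - v‖ ≤ D := by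
  obtain ⟨D, hD⟩ := Metric.isBounded_iff.1 hS.isBounded
  refine ⟨max D 1, by positivity, fun u hu v hv => ?_⟩
  rw [← dist_eq_norm]
  exact (hD hu hv).trans (le_max_left _ _)

/-- Corollary 1: with parameters `μ = K^{-1/6}` and `τ = K^{-5/6}`, the
R-PDCG iterates admit an index `t ∈ {⌈K/2⌉,…,K−1}` with
`G_X(x_t,y_t) + G_Y(x_t,y_t) ≤ C·K^{-1/6}` for a constant `C` depending only on the data. -/
theorem stmt_8 {E F : Type*}
    [NormedAddCommGroup E] [InnerProductSpace ℝ E] [FiniteDimensional ℝ E]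
    [NormedAddCommGroup F] [InnerProductSpace ℝ F] [FiniteDimensional ℝ F]
    (X : Set E) (Y : Set F)
    (hXne : X.Nonempty) (hXconv : Convex ℝ X) (hXcomp : IsCompact X)
    (hYne : Y.Nonempty) (hYconv : Convex ℝ Y) (hYcomp : IsCompact Y)
    (L : E → F → ℝ) (hLdiff : Differentiable ℝ (fun p : E × F => L p.1 p.2))
    (Lxx Lyy Lyx : ℝ) (hLxx : 0 ≤ Lxx) (hLyy : 0 ≤ Lyy) (hLyx : 0 < Lyx)
    (hlipx : ∀ x ∈ X, ∀ x' ∈ X, ∀ y ∈ Y, ∀ y' ∈ Y,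
      ‖gradX L x y - gradX L x' y'‖ ≤ Lxx * ‖x - x'‖ + Lyx * ‖y - y'‖)
    (hlipy : ∀ x ∈ X, ∀ x' ∈ X, ∀ y ∈ Y, ∀ y' ∈ Y,
      ‖gradY L x y - gradY L x' y'‖ ≤ Lyx * ‖x - x'‖ + Lyy * ‖y - y'‖)
    (hconc : ∀ x ∈ X, ConcaveOn ℝ Set.univ (L x))
    (α : ℝ) (hα : 0 < α)
    (hYsc : ∀ u ∈ Y, ∀ v ∈ Y, ∀ γ ∈ Set.Icc (0 : ℝ) 1, ∀ w : F, ‖w‖ = 1 →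
      γ • u + (1 - γ) • v + (γ * (1 - γ) * (α / 2) * ‖u - v‖ ^ 2) • w ∈ Y)
    (x₀ : E) (y₀ : F) (hx₀ : x₀ ∈ X) (hy₀ : y₀ ∈ Y) :
    ∃ C : ℝ, 0 < C ∧ ∀ K : ℕ, 2 ≤ K →
      ∀ (xseq : ℕ → E) (yseq : ℕ → F) (s : ℕ → E) (p : ℕ → F),
        xseq 0 = x₀ → yseq 0 = y₀ →
        (∀ k < K, s k ∈ X ∧ ∀ x ∈ X,
          ⟪gradX L (xseq k) (yseq k), s k⟫ ≤ ⟪gradX L (xseq k) (yseq k), x⟫) →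
        (∀ k < K, xseq (k + 1) =
          ((K : ℝ) ^ (-(5 : ℝ) / 6)) • s k
          + (1 - (K : ℝ) ^ (-(5 : ℝ) / 6)) • xseq k) →
        (∀ k < K, p k ∈ Y ∧ ∀ y ∈ Y,
          ⟪gradY L (xseq k) (yseq k)
            - ((K : ℝ) ^ (-(1 : ℝ) / 6)) • (yseq k - y₀), y⟫ ≤
          ⟪gradY L (xseq k) (yseq k)
            - ((K : ℝ) ^ (-(1 : ℝ) / 6)) • (yseq k - y₀), p k⟫) →
        (∀ k < K, yseq (k + 1) =
          (min 1 (α / (4 * (Lyy + (K : ℝ) ^ (-(1 : ℝ) / 6))) *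
            ‖gradY L (xseq k) (yseq k)
              - ((K : ℝ) ^ (-(1 : ℝ) / 6)) • (yseq k - y₀)‖)) • p k
          + (1 - min 1 (α / (4 * (Lyy + (K : ℝ) ^ (-(1 : ℝ) / 6))) *
            ‖gradY L (xseq k) (yseq k)
              - ((K : ℝ) ^ (-(1 : ℝ) / 6)) • (yseq k - y₀)‖)) • yseq k) →
        ∃ t : ℕ, (K + 1) / 2 ≤ t ∧ t ≤ K - 1 ∧
          sSup ((fun x' => ⟪gradX L (xseq t) (yseq t), xseq t - x'⟫) '' X)
          + sSup ((fun y' => ⟪gradY L (xseq t) (yseq t), y' - yseq t⟫) '' Y)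
          ≤ C * (K : ℝ) ^ (-(1 : ℝ) / 6) := by
  obtain ⟨DX, hDX0, hDX⟩ := hXcomp.exists_pos_norm_sub_le
  obtain ⟨DY, hDY0, hDY⟩ := hYcomp.exists_pos_norm_sub_le
  set D := max DX DY
  have hD0 : 0 < D := lt_max_of_lt_left hDX0
  set Gx := ‖gradX L x₀ y₀‖ + (Lxx * D + Lyx * D)
  set Gy := ‖gradY L x₀ y₀‖ + (Lyx * D + Lyy * D)
  have hDX' : ∀ x ∈ X, ∀ x' ∈ X, ‖x - x'‖ ≤ D :=
    fun x hx x' hx' => (hDX x hx x' hx').trans (le_max_left _ _)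
  have hDY' : ∀ y ∈ Y, ∀ y' ∈ Y, ‖y - y'‖ ≤ D :=
    fun y hy y' hy' => (hDY y hy y' hy').trans (le_max_right _ _)
  have hdx : ∀ x y, HasGradientAt (fun x => L x y) (gradX L x y) x := fun x y => by
    have : DifferentiableAt ℝ (fun x => L x y) x :=
      (hLdiff (x, y)).comp (f := fun x => (x, y)) x (differentiableAt_id.prodMk (differentiableAt_const y))
    exact this.hasGradientAt
  have hdy : ∀ x y, HasGradientAt (L x) (gradY L x y) y := fun x y => by
    have : DifferentiableAt ℝ (fun y => L x y) y :=
      (hLdiff (x, y)).comp (f := fun y => (x, y)) y ((differentiableAt_const x).prodMk differentiableAt_id)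
    exact this.hasGradientAt
  have H : IsSmoothSaddle X Y L (gradX L) (gradY L) Lxx Lyx Lyy α D Gx Gy :=
    { convex_X := hXconv
      convex_Y := hYconv
      hasGradientAt_x := hdx
      hasGradientAt_y := hdy
      Lxx_nonneg := hLxx
      Lyx_nonneg := hLyx.le
      Lyy_nonneg := hLyy
      lip_x := hlipx
      lip_y := hlipy
      concave := hconc
      α_pos := hα
      stronglyConvex := hYsc
      D_pos := hD0
      norm_sub_le_x := hDX'
      norm_sub_le_y := hDY'
      norm_gx_le := fun x hx y hy => by
        have h1 := hlipx x hx x₀ hx₀ y hy y₀ hy₀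
        have h2 : Lxx * ‖x - x₀‖ + Lyx * ‖y - y₀‖ ≤ Lxx * D + Lyx * D := by
          gcongr
          exacts [hDX' x hx x₀ hx₀, hDY' y hy y₀ hy₀]
        linarith [norm_le_norm_add_norm_sub (gradX L x₀ y₀) (gradX L x y),
          norm_sub_rev (gradX L x₀ y₀) (gradX L x y)]
      norm_gy_le := fun x hx y hy => by
        have h1 := hlipy x hx x₀ hx₀ y hy y₀ hy₀
        have h2 : Lyx * ‖x - x₀‖ + Lyy * ‖y - y₀‖ ≤ Lyx * D + Lyy * D := by
          gcongr
          exacts [hDX' x hx x₀ hx₀, hDY' y hy y₀ hy₀]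
        linarith [norm_le_norm_add_norm_sub (gradY L x₀ y₀) (gradY L x y),
          norm_sub_rev (gradY L x₀ y₀) (gradY L x y)] }
  have hGxpos : 0 ≤ Gx := by positivity
  have hGD : 0 < Gy + D := by positivity
  set cg := min (α / (4 * (Lyy + 1))) (1 / (Gy + D))
  have hcg0 : 0 < cg := lt_min (by positivity) (by positivity)
  have hcg1 : cg * (Gy + D) ≤ 1 := (le_div_iff₀ hGD).1 (min_le_right _ _)
  set B := 1 + 16 * Lyx * D / cg + 2 * Lyx * D + 16 / cg
  have hB0 : 0 ≤ B := by positivity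
  refine ⟨((Lyx * D * (2 * B + 2 * Lyx * D) + Lxx / 2 * D ^ 2) + 3 * Gx * D
    + (1 + 2 * D * B ^ 2 / cg)) + D ^ 2, by positivity, ?_⟩
  intro K hK2 x y s p hx0 hy0 hs hxs hp hys
  obtain ⟨ν, hν0, hν1, hνK, hμ, hτ⟩ := exists_pow_of_natCast (by omega : 1 ≤ K)
  simp only [hμ] at hp hys ⊢
  rw [hτ] at hxs
  have I : IsRPDCG X Y (gradY L) α Lyy (ν ^ 2) (ν ^ 10) K x s y p y₀
      (fun k => gradY L (x k) (y k) - ν ^ 2 • (y k - y₀))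
      (fun k => min 1 (α / (4 * (Lyy + ν ^ 2))
        * ‖gradY L (x k) (y k) - ν ^ 2 • (y k - y₀)‖)) :=
    { x_zero_mem := hx0 ▸ hx₀
      y_zero_mem := hy0 ▸ hy₀
      y₀_mem := hy₀
      s_mem := fun k hk => (hs k hk).1
      p_mem := fun k hk => (hp k hk).1
      p_max := fun k hk => (hp k hk).2
      g_eq := fun _ => rfl
      σ_eq := fun _ => rfl
      x_succ := hxs
      y_succ := hys }
  have hmax : ∀ k, ∃ z ∈ Y, ∀ u ∈ Y,
      tikhonov (L (x k)) (ν ^ 2) y₀ u ≤ tikhonov (L (x k)) (ν ^ 2) y₀ z := fun k =>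
    hYcomp.exists_isMaxOn hYne fun v _ =>
      ((hdy (x k) v).tikhonov_sub (ν ^ 2) y₀).differentiableAt.continuousAt.continuousWithinAt
  choose z hzY hzmax using hmax
  obtain ⟨t, hmt, htK, hxt, hyt, hle⟩ := I.exists_gap_le H hν0 hν1 hK2 hνK hcg0 (min_le_left _ _)
    hcg1 (fun k _ => hzY k) (fun k _ => hzmax k) le_rfl
  refine ⟨t, hmt, by omega, ?_⟩
  have hX : sSup ((fun x' => ⟪gradX L (x t) (y t), x t - x'⟫) '' X)
      ≤ ⟪gradX L (x t) (y t), x t - s t⟫ := by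
    refine csSup_le (hXne.image _) ?_
    rintro _ ⟨x', hx', rfl⟩
    have := (hs t htK).2 x' hx'
    simp only [inner_sub_right]
    linarith
  have hY : sSup ((fun y' => ⟪gradY L (x t) (y t), y' - y t⟫) '' Y)
      ≤ ⟪gradY L (x t) (y t) - ν ^ 2 • (y t - y₀), p t - y t⟫ + D ^ 2 * ν ^ 2 := by
    refine csSup_le (hYne.image _) ?_
    rintro _ ⟨y', hy', rfl⟩
    have h1 := (hp t htK).2 y' hy'
    have h2 : ⟪y t - y₀, y' - y t⟫ ≤ D * D :=
      (real_inner_le_norm _ _).trans (mul_le_mul (hDY' _ hyt _ hy₀) (hDY' _ hy' _ hyt)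
        (norm_nonneg _) hD0.le)
    have h3 : ⟪gradY L (x t) (y t), y' - y t⟫
        = ⟪gradY L (x t) (y t) - ν ^ 2 • (y t - y₀), y' - y t⟫
          + ν ^ 2 * ⟪y t - y₀, y' - y t⟫ := by
      rw [← real_inner_smul_left, ← inner_add_left, sub_add_cancel]
    have h4 := mul_le_mul_of_nonneg_left h2 (sq_nonneg ν)
    simp only [h3]
    rw [inner_sub_right _ y', inner_sub_right _ (p t)]
    linarith
  linarith
end

section
/- Assume in addition that Y is α-strongly convex for some α > 0, that L_yy > 0, and that 𝓛(x,·) is μ̃-strongly concave for every x ∈ X, for some μ̃ > 0. Fix (x₀,y₀) ∈ X×Y and run the R-PDCG iteration with μ = 0, i.e. g_k = ∇_y𝓛(x_k,y_k), σ_k = min{1, (α/(4·L_yy))·‖g_k‖}, and constant primal step τ = K^{−3/4}. There exists a constant C > 0, depending only on 𝓛, X, Y, x₀, y₀, L_xx, L_yx, L_yy, α and μ̃, such that for every integer K ≥ 2 there exists t ∈ {⌈K/2⌉, …, K−1} with G_X(x_t,y_t) ≤ C·K^{−1/4} and G_Y(x_t,y_t) ≤ C·K^{−1/2}. -/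
open scoped RealInnerProductSpace

/-- First-order expansion with a remainder controlled by the variation of the gradient along the
segment. -/
theorem abs_sub_sub_inner_le_of_norm_gradient_sub_le {H : Type*} [NormedAddCommGroup H]
    [InnerProductSpace ℝ H] [CompleteSpace H] {f : H → ℝ} (hf : Differentiable ℝ f) {c x x' : H}
    {M : ℝ} (hM : ∀ z ∈ segment ℝ x x', ‖gradient f z - c‖ ≤ M) :
    |f x' - f x - ⟪c, x' - x⟫| ≤ M * ‖x' - x‖ := by
  have h := (convex_segment x x').norm_image_sub_le_of_norm_hasFDerivWithin_le'
    (f := f) (f' := fun z => InnerProductSpace.toDual ℝ H (gradient f z))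
    (φ := InnerProductSpace.toDual ℝ H c) (C := M)
    (fun z _ => ((hf z).hasGradientAt.hasFDerivAt).hasFDerivWithinAt)
    (fun z hz => by simpa only [← map_sub, LinearIsometryEquiv.norm_map] using hM z hz)
    (left_mem_segment ℝ x x') (right_mem_segment ℝ x x')
  simpa only [InnerProductSpace.toDual_apply_apply, Real.norm_eq_abs] using h

/-- A concave differentiable function lies below its tangent planes. -/
theorem ConcaveOn.le_add_inner_gradient_s9 {H : Type*} [NormedAddCommGroup H]
    [InnerProductSpace ℝ H] [CompleteSpace H] {f : H → ℝ} (hc : ConcaveOn ℝ Set.univ f)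
    (hf : Differentiable ℝ f) (y z : H) : f z ≤ f y + ⟪gradient f y, z - y⟫ := by
  have hd : HasDerivAt (fun t : ℝ => f (AffineMap.lineMap y z t)) ⟪gradient f y, z - y⟫ 0 := by
    have hg : HasFDerivAt f (InnerProductSpace.toDual ℝ H (gradient f y))
        (AffineMap.lineMap y z (0 : ℝ)) := by
      simpa using (hf y).hasGradientAt.hasFDerivAt
    simpa using! hg.comp_hasDerivAt (0 : ℝ) AffineMap.hasDerivAt_lineMap
  have hc' : ConcaveOn ℝ Set.univ (fun t : ℝ => f (AffineMap.lineMap y z t)) :=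
    hc.comp_affineMap (AffineMap.lineMap y z)
  have h := hc'.slope_le_of_hasDerivAt (Set.mem_univ 0) (Set.mem_univ 1) one_pos hd
  simp only [slope_def_field, AffineMap.lineMap_apply_one, AffineMap.lineMap_apply_zero, sub_zero,
    div_one] at h
  linarith

/-- Quadratic growth of a strongly concave function away from its maximizer on a convex set. -/
theorem StrongConcaveOn.quadratic_growth {H : Type*} [NormedAddCommGroup H]
    [NormedSpace ℝ H] {f : H → ℝ} {m : ℝ} {Y : Set H} (hf : StrongConcaveOn Set.univ m f)
    (hY : Convex ℝ Y) {u v : H} (hu : u ∈ Y) (hmax : ∀ y ∈ Y, f y ≤ f u) (hv : v ∈ Y) :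
    m / 4 * ‖u - v‖ ^ 2 ≤ f u - f v := by
  obtain ⟨-, hf⟩ : UniformConcaveOn _ _ _ := hf
  have h := hf (Set.mem_univ u) (Set.mem_univ v) (a := 1 / 2) (b := 1 / 2)
    (by norm_num) (by norm_num) (by norm_num)
  have h' := hmax _ (hY hu hv (a := 1 / 2) (b := 1 / 2) (by norm_num) (by norm_num) (by norm_num))
  simp only [smul_eq_mul] at h
  linarith

/-- Over a strongly convex set, the linear maximization gap dominates the squared distance. -/
theorem gap_ge_of_strongly_convex {H : Type*} [NormedAddCommGroup H] [InnerProductSpace ℝ H]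
    {Y : Set H} {α : ℝ}
    (hY : ∀ u ∈ Y, ∀ v ∈ Y, ∀ γ ∈ Set.Icc (0 : ℝ) 1, ∀ w : H, ‖w‖ = 1 →
      γ • u + (1 - γ) • v + (γ * (1 - γ) * (α / 2) * ‖u - v‖ ^ 2) • w ∈ Y)
    {g y p : H} (hy : y ∈ Y) (hp : p ∈ Y) (hmax : ∀ z ∈ Y, ⟪g, z⟫ ≤ ⟪g, p⟫) :
    3 / 8 * α * ‖g‖ * ‖p - y‖ ^ 2 ≤ ⟪g, p - y⟫ := by
  rcases eq_or_ne g 0 with rfl | hg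
  · simp
  have hn : ‖g‖ ≠ 0 := norm_ne_zero_iff.2 hg
  have h := hmax _ (hY p hp y hy (3 / 4) (by constructor <;> norm_num) (‖g‖⁻¹ • g)
    (by rw [norm_smul, norm_inv, norm_norm, inv_mul_cancel₀ hn]))
  have hgg : ‖g‖⁻¹ * (‖g‖ * ‖g‖) = ‖g‖ := by field_simp
  simp only [inner_add_right, inner_smul_right, real_inner_self_eq_norm_mul_norm, hgg] at h
  rw [inner_sub_right]
  linarith

/-- Ascent guaranteed by a short-step conditional gradient update over a strongly convex set. -/
theorem conditional_gradient_ascent {H : Type*} [NormedAddCommGroup H] [InnerProductSpace ℝ H]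
    [CompleteSpace H] {f : H → ℝ} (hf : Differentiable ℝ f) {Y : Set H} (hY : Convex ℝ Y)
    {y p : H} (hy : y ∈ Y) (hp : p ∈ Y) {ℓ α σ : ℝ} (hℓ : 0 < ℓ)
    (hlip : ∀ z ∈ Y, ‖gradient f z - gradient f y‖ ≤ ℓ * ‖z - y‖)
    (hgap : 3 / 8 * α * ‖gradient f y‖ * ‖p - y‖ ^ 2 ≤ ⟪gradient f y, p - y⟫)
    (hσ0 : 0 ≤ σ) (hσ1 : σ ≤ 1) (hσ : σ ≤ α / (4 * ℓ) * ‖gradient f y‖) :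
    f y + σ / 3 * ⟪gradient f y, p - y⟫ ≤ f (σ • p + (1 - σ) • y) := by
  have hmem : σ • p + (1 - σ) • y ∈ Y := hY hp hy hσ0 (by linarith) (by ring)
  have hsub : σ • p + (1 - σ) • y - y = σ • (p - y) := by module
  have h := abs_sub_sub_inner_le_of_norm_gradient_sub_le hf (c := gradient f y) (x := y)
    (x' := σ • p + (1 - σ) • y) (M := ℓ * (σ * ‖p - y‖)) (by
      intro z hz
      have hzy : ‖z - y‖ ≤ σ * ‖p - y‖ := by
        have := norm_sub_le_of_mem_segment hz
        rwa [hsub, norm_smul, Real.norm_of_nonneg hσ0] at this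
      exact (hlip z (hY.segment_subset hy hmem hz)).trans (by gcongr))
  rw [hsub, norm_smul, Real.norm_of_nonneg hσ0, inner_smul_right] at h
  have h1 := (abs_le.1 h).1
  have h2 : ℓ * σ ≤ α / 4 * ‖gradient f y‖ := by
    calc ℓ * σ ≤ ℓ * (α / (4 * ℓ) * ‖gradient f y‖) := by gcongr
      _ = α / 4 * ‖gradient f y‖ := by field_simp
  have h3 := mul_le_mul_of_nonneg_right h2 (mul_nonneg hσ0 (sq_nonneg ‖p - y‖))
  have h4 := mul_le_mul_of_nonneg_left hgap hσ0
  nlinarith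

/-- One dual step from `y` to a point `y'` of objective gain at least `σ / 3` times the gap
decreases the suboptimality by a multiple of its `3/2`-th power plus the squared gap. -/
theorem suboptimality_decrease {u h g G D M κ m σ v f' : ℝ} (hm : 0 < m) (hκ : 0 < κ)
    (hM : 0 < M) (hD : 0 < D) (hu : 0 ≤ u) (hg : 0 ≤ g) (hgM : g ≤ M) (hh : h = u ^ 2)
    (hhG : h ≤ G) (hhg : h ≤ g * v) (hv : m * v ^ 2 ≤ h) (hGD : G ≤ g * D)
    (hσ : σ = min 1 (κ * g)) (hf : σ / 3 * G ≤ f') :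
    min κ (1 / M) / 6 * (√m * u ^ 3 + G ^ 2 / D) ≤ f' := by
  set c := min κ (1 / M)
  have hc : 0 < c := lt_min hκ (by positivity)
  have hG : 0 ≤ G := (hh ▸ sq_nonneg u).trans hhG
  have hcσ : c * g ≤ σ := by
    rw [hσ]
    refine le_min ?_ (mul_le_mul_of_nonneg_right (min_le_left _ _) hg)
    calc c * g ≤ 1 / M * M := mul_le_mul (min_le_right _ _) hgM hg (by positivity)
      _ = 1 := by field_simp
  have hsm : √m * √m = m := Real.mul_self_sqrt hm.le
  have hvu : √m * v ≤ u := by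
    refine abs_le_of_sq_le_sq' ?_ hu |>.2
    nlinarith
  have hgu : √m * u ≤ g := by
    rcases hu.eq_or_lt with h0 | h0
    · rw [← h0]; simpa using hg
    · have : √m * u * u ≤ g * u := by
        calc √m * u * u = √m * h := by rw [hh]; ring
          _ ≤ √m * (g * v) := by gcongr
          _ = g * (√m * v) := by ring
          _ ≤ g * u := by gcongr
      exact le_of_mul_le_mul_right this h0
  have h1 : √m * u ^ 3 ≤ g * G := by
    calc √m * u ^ 3 = (√m * u) * h := by rw [hh]; ring
      _ ≤ g * G := mul_le_mul hgu hhG (hh ▸ sq_nonneg u) hg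
  have h2 : G ^ 2 / D ≤ g * G := by
    rw [div_le_iff₀ hD]
    nlinarith
  calc c / 6 * (√m * u ^ 3 + G ^ 2 / D) ≤ c / 6 * (g * G + g * G) := by gcongr
    _ = c * g / 3 * G := by ring
    _ ≤ σ / 3 * G := by gcongr
    _ ≤ f' := hf

/-- One-sided first-order estimate for the max function of a saddle objective with quadratic
growth, at a possibly suboptimal dual point `z`. -/
theorem max_function_sub_le {E F : Type*}
    [NormedAddCommGroup E] [InnerProductSpace ℝ E] [CompleteSpace E] [NormedAddCommGroup F]
    {X : Set E} {Y : Set F} (hX : Convex ℝ X) {L : E → F → ℝ}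
    (hL : ∀ y, Differentiable ℝ (fun x => L x y)) {Lxx Lyx m : ℝ}
    (hLxx : 0 ≤ Lxx) (hLyx : 0 < Lyx) (hm : 0 < m)
    (hlip : ∀ x ∈ X, ∀ x' ∈ X, ∀ y ∈ Y, ∀ y' ∈ Y,
      ‖gradX L x y - gradX L x' y'‖ ≤ Lxx * ‖x - x'‖ + Lyx * ‖y - y'‖)
    {x x' : E} {y y' z : F} (hx : x ∈ X) (hx' : x' ∈ X) (hy' : y' ∈ Y) (hz : z ∈ Y)
    (hgrow : ∀ w ∈ Y, m * ‖y - w‖ ^ 2 ≤ L x y - L x w) :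
    L x' y' - L x y ≤ ⟪gradX L x z, x' - x⟫ + (Lxx + Lyx ^ 2 / (4 * m)) * ‖x' - x‖ ^ 2
      + Lyx / √m * ‖x' - x‖ * √(L x y - L x z) := by
  have h := abs_sub_sub_inner_le_of_norm_gradient_sub_le (hL y') (c := gradX L x z) (x := x)
    (x' := x') (M := Lxx * ‖x' - x‖ + Lyx * ‖y' - z‖) (by
      intro w hw
      refine (hlip w (hX.segment_subset hx hx' hw) x hx y' hy' z hz).trans ?_
      have := norm_sub_le_of_mem_segment hw
      gcongr)
  have h1 := (abs_le.1 h).2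
  have htri : ‖y' - z‖ ≤ ‖y - y'‖ + ‖y - z‖ := by
    rw [norm_sub_rev y y']; exact norm_sub_le_norm_sub_add_norm_sub _ _ _
  have hyz : ‖y - z‖ ≤ √(L x y - L x z) / √m := by
    rw [← Real.sqrt_div' _ hm.le]
    apply Real.le_sqrt_of_sq_le
    rw [le_div_iff₀ hm, mul_comm]
    exact hgrow z hz
  have h2 := hgrow y' hy'
  have hyoung : Lyx * ‖y - y'‖ * ‖x' - x‖
      ≤ m * ‖y - y'‖ ^ 2 + Lyx ^ 2 / (4 * m) * ‖x' - x‖ ^ 2 := by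
    have : m * ‖y - y'‖ ^ 2 + Lyx ^ 2 / (4 * m) * ‖x' - x‖ ^ 2 - Lyx * ‖y - y'‖ * ‖x' - x‖
        = m * (‖y - y'‖ - Lyx / (2 * m) * ‖x' - x‖) ^ 2 := by field_simp; ring
    have := mul_nonneg hm.le (sq_nonneg (‖y - y'‖ - Lyx / (2 * m) * ‖x' - x‖))
    linarith
  have h3 : Lyx * ‖y' - z‖ * ‖x' - x‖ ≤ Lyx * ‖y - y'‖ * ‖x' - x‖
      + Lyx / √m * ‖x' - x‖ * √(L x y - L x z) := by
    calc Lyx * ‖y' - z‖ * ‖x' - x‖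
        ≤ Lyx * (‖y - y'‖ + √(L x y - L x z) / √m) * ‖x' - x‖ := by gcongr; linarith
      _ = _ := by ring
  linarith

/-- Absorption of a linear term at scale `κ ^ 3` into a cubic term. -/
theorem mul_pow_three_mul_le {a e κ u : ℝ} (ha : 0 < a) (he : 0 ≤ e) (hκ0 : 0 ≤ κ) (hκ1 : κ ≤ 1)
    (hu : 0 ≤ u) : e * κ ^ 3 * u ≤ a * u ^ 3 + e * (e / a + 1) * κ ^ 4 := by
  have hn : 0 ≤ e / a := by positivity
  rcases le_total u ((e / a + 1) * κ) with h | h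
  · calc e * κ ^ 3 * u ≤ e * κ ^ 3 * ((e / a + 1) * κ) := by gcongr
      _ = e * (e / a + 1) * κ ^ 4 := by ring
      _ ≤ _ := by have := pow_nonneg hu 3; nlinarith
  · have h1 : e * κ ^ 3 ≤ a * u ^ 2 := by
      calc e * κ ^ 3 ≤ e * κ ^ 2 := by
            gcongr _ * ?_; exact pow_le_pow_of_le_one hκ0 hκ1 (by norm_num)
        _ = a * ((e / a) * κ ^ 2) := by field_simp
        _ ≤ a * ((e / a + 1) * κ) ^ 2 := by
            gcongr
            nlinarith [mul_nonneg hn (sq_nonneg κ), sq_nonneg (e / a * κ), sq_nonneg κ]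
        _ ≤ a * u ^ 2 := by gcongr
    have := mul_le_mul_of_nonneg_right h1 hu
    have : 0 ≤ e * (e / a + 1) * κ ^ 4 := by positivity
    nlinarith

/-- Averaging a telescoping bound over the second half of the horizon. -/
theorem exists_le_of_telescoping_s9 {K : ℕ} (hK : 2 ≤ K) {f V : ℕ → ℝ} {W B κ : ℝ}
    (hκ : (K : ℝ) * κ ^ 4 = 1) (hstep : ∀ k < K, f k ≤ V k - V (k + 1) + B * κ ^ 4)
    (hV : ∀ k ≤ K, |V k| ≤ W) (hB : 0 ≤ B) :
    ∃ t, (K + 1) / 2 ≤ t ∧ t ≤ K - 1 ∧ f t ≤ 3 * (2 * W + B) * κ ^ 4 := by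
  have hT : (K + 1) / 2 < K := by omega
  have hW : 0 ≤ W := (abs_nonneg _).trans (hV 0 (Nat.zero_le K))
  have hκ4 : 0 ≤ κ ^ 4 := by positivity
  have hne : (Finset.Ico ((K + 1) / 2) K).Nonempty := Finset.nonempty_Ico.2 hT
  obtain ⟨t, ht, hft⟩ := Finset.exists_le_of_sum_le (f := f)
    (g := fun _ => 3 * (2 * W + B) * κ ^ 4) hne (by
      have hcard : (K : ℝ) ≤ 3 * ((K - (K + 1) / 2 : ℕ) : ℝ) := by
        exact_mod_cast (by omega : K ≤ 3 * (K - (K + 1) / 2))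
      have hcard' : ((K - (K + 1) / 2 : ℕ) : ℝ) ≤ K := by exact_mod_cast Nat.sub_le _ _
      have htel : ∑ k ∈ Finset.Ico ((K + 1) / 2) K, (V k - V (k + 1))
          = V ((K + 1) / 2) - V K := by
        have := Finset.sum_Ico_sub V hT.le
        rw [← neg_inj, ← Finset.sum_neg_distrib]
        simpa using this
      calc ∑ k ∈ Finset.Ico ((K + 1) / 2) K, f k
          ≤ ∑ k ∈ Finset.Ico ((K + 1) / 2) K, (V k - V (k + 1) + B * κ ^ 4) :=
            Finset.sum_le_sum fun k hk => hstep k (Finset.mem_Ico.1 hk).2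
        _ = V ((K + 1) / 2) - V K + ((K - (K + 1) / 2 : ℕ) : ℝ) * (B * κ ^ 4) := by
            rw [Finset.sum_add_distrib, htel]; simp
        _ ≤ 2 * W + B := by
            have h1 := (abs_le.1 (hV _ hT.le)).2
            have h2 := (abs_le.1 (hV K le_rfl)).1
            have h3 := mul_le_mul_of_nonneg_right hcard' (mul_nonneg hB hκ4)
            nlinarith
        _ = (2 * W + B) * (K * κ ^ 4) := by rw [hκ, mul_one]
        _ ≤ (2 * W + B) * (3 * ((K - (K + 1) / 2 : ℕ) : ℝ) * κ ^ 4) := by gcongr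
        _ = _ := by simp; ring)
  rw [Finset.mem_Ico] at ht
  exact ⟨t, ht.1, by omega, hft⟩

/-- A bounded set admits a positive bound on the distances between its points. -/
theorem exists_pos_norm_sub_le {H : Type*} [SeminormedAddCommGroup H] {A : Set H}
    (hA : Bornology.IsBounded A) : ∃ D : ℝ, 0 < D ∧ ∀ x ∈ A, ∀ x' ∈ A, ‖x - x'‖ ≤ D :=
  ⟨Metric.diam A + 1, by linarith [Metric.diam_nonneg (s := A)], fun x hx x' hx' => by
    rw [← dist_eq_norm]; linarith [Metric.dist_le_diam_of_mem hA hx hx']⟩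

/-- Theorem 2, R-PDCG for nonconvex-strongly concave problems, `μ = 0`,
`τ = K^{-3/4}`: there exist an index `t ∈ {⌈K/2⌉,…,K−1}` with
`G_X(x_t,y_t) ≤ C·K^{-1/4}` and `G_Y(x_t,y_t) ≤ C·K^{-1/2}`. -/
theorem stmt_9 {E F : Type*}
    [NormedAddCommGroup E] [InnerProductSpace ℝ E] [FiniteDimensional ℝ E]
    [NormedAddCommGroup F] [InnerProductSpace ℝ F] [FiniteDimensional ℝ F]
    (X : Set E) (Y : Set F)
    (hXne : X.Nonempty) (hXconv : Convex ℝ X) (hXcomp : IsCompact X)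
    (hYne : Y.Nonempty) (hYconv : Convex ℝ Y) (hYcomp : IsCompact Y)
    (L : E → F → ℝ) (hLdiff : Differentiable ℝ (fun p : E × F => L p.1 p.2))
    (Lxx Lyy Lyx : ℝ) (hLxx : 0 ≤ Lxx) (hLyy : 0 < Lyy) (hLyx : 0 < Lyx)
    (hlipx : ∀ x ∈ X, ∀ x' ∈ X, ∀ y ∈ Y, ∀ y' ∈ Y,
      ‖gradX L x y - gradX L x' y'‖ ≤ Lxx * ‖x - x'‖ + Lyx * ‖y - y'‖)
    (hlipy : ∀ x ∈ X, ∀ x' ∈ X, ∀ y ∈ Y, ∀ y' ∈ Y,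
      ‖gradY L x y - gradY L x' y'‖ ≤ Lyx * ‖x - x'‖ + Lyy * ‖y - y'‖)
    (α : ℝ) (hα : 0 < α)
    (hYsc : ∀ u ∈ Y, ∀ v ∈ Y, ∀ γ ∈ Set.Icc (0 : ℝ) 1, ∀ w : F, ‖w‖ = 1 →
      γ • u + (1 - γ) • v + (γ * (1 - γ) * (α / 2) * ‖u - v‖ ^ 2) • w ∈ Y)
    (μt : ℝ) (hμt : 0 < μt)
    (hsconc : ∀ x ∈ X, ConcaveOn ℝ Set.univ (fun y : F => L x y + μt / 2 * ‖y‖ ^ 2))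
    (x₀ : E) (y₀ : F) (hx₀ : x₀ ∈ X) (hy₀ : y₀ ∈ Y) :
    ∃ C : ℝ, 0 < C ∧ ∀ K : ℕ, 2 ≤ K →
      ∀ (xseq : ℕ → E) (yseq : ℕ → F) (s : ℕ → E) (p : ℕ → F),
        xseq 0 = x₀ → yseq 0 = y₀ →
        (∀ k < K, s k ∈ X ∧ ∀ x ∈ X,
          ⟪gradX L (xseq k) (yseq k), s k⟫ ≤ ⟪gradX L (xseq k) (yseq k), x⟫) →
        (∀ k < K, xseq (k + 1) =
          ((K : ℝ) ^ (-(3 : ℝ) / 4)) • s k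
          + (1 - (K : ℝ) ^ (-(3 : ℝ) / 4)) • xseq k) →
        (∀ k < K, p k ∈ Y ∧ ∀ y ∈ Y,
          ⟪gradY L (xseq k) (yseq k), y⟫ ≤ ⟪gradY L (xseq k) (yseq k), p k⟫) →
        (∀ k < K, yseq (k + 1) =
          (min 1 (α / (4 * Lyy) * ‖gradY L (xseq k) (yseq k)‖)) • p k
          + (1 - min 1 (α / (4 * Lyy) * ‖gradY L (xseq k) (yseq k)‖)) • yseq k) →
        ∃ t : ℕ, (K + 1) / 2 ≤ t ∧ t ≤ K - 1 ∧
          sSup ((fun x' => ⟪gradX L (xseq t) (yseq t), xseq t - x'⟫) '' X)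
            ≤ C * (K : ℝ) ^ (-(1 : ℝ) / 4) ∧
          sSup ((fun y' => ⟪gradY L (xseq t) (yseq t), y' - yseq t⟫) '' Y)
            ≤ C * (K : ℝ) ^ (-(1 : ℝ) / 2) := by
  have hcont : Continuous (fun q : E × F => L q.1 q.2) := hLdiff.continuous
  have hLX : ∀ y, Differentiable ℝ (fun x => L x y) := fun y =>
    hLdiff.comp (differentiable_id.prodMk (differentiable_const y))
  have hLY : ∀ x, Differentiable ℝ (fun y => L x y) := fun x =>
    hLdiff.comp ((differentiable_const x).prodMk differentiable_id)
  have hstrong : ∀ x ∈ X, StrongConcaveOn Set.univ μt (fun y => L x y) := fun x hx =>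
    strongConcaveOn_iff_convex.2 (hsconc x hx)
  have hconc : ∀ x ∈ X, ConcaveOn ℝ Set.univ (fun y => L x y) := fun x hx =>
    strongConcaveOn_zero.1 ((hstrong x hx).mono hμt.le)
  have hmaxex : ∀ x, ∃ y ∈ Y, ∀ z ∈ Y, L x z ≤ L x y := fun x =>
    hYcomp.exists_isMaxOn hYne (hLY x).continuous.continuousOn
  choose ys hysY hysmax using hmaxex
  obtain ⟨DX, hDX, hdX⟩ : ∃ D : ℝ, 0 < D ∧ ∀ x ∈ X, ∀ x' ∈ X, ‖x - x'‖ ≤ D :=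
    exists_pos_norm_sub_le hXcomp.isBounded
  obtain ⟨DY, hDY, hdY⟩ : ∃ D : ℝ, 0 < D ∧ ∀ y ∈ Y, ∀ y' ∈ Y, ‖y - y'‖ ≤ D :=
    exists_pos_norm_sub_le hYcomp.isBounded
  obtain ⟨W, hW⟩ : ∃ W : ℝ, ∀ x ∈ X, ∀ y ∈ Y, |L x y| ≤ W := by
    obtain ⟨W, hW⟩ := (hXcomp.prod hYcomp).exists_bound_of_continuousOn hcont.continuousOn
    exact ⟨W, fun x hx y hy => hW (x, y) ⟨hx, hy⟩⟩
  set M := ‖gradY L x₀ y₀‖ + (Lyx * DX + Lyy * DY) with hMdef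
  have hM : 0 < M := by positivity
  have hgM : ∀ x ∈ X, ∀ y ∈ Y, ‖gradY L x y‖ ≤ M := by
    intro x hx y hy
    have h1 : ‖gradY L x y - gradY L x₀ y₀‖ ≤ Lyx * DX + Lyy * DY := by
      refine (hlipy x hx x₀ hx₀ y hy y₀ hy₀).trans ?_
      gcongr
      exacts [hdX x hx x₀ hx₀, hdY y hy y₀ hy₀]
    linarith [norm_le_norm_add_norm_sub' (gradY L x y) (gradY L x₀ y₀)]
  set m := μt / 4 with hmdef
  have hm : 0 < m := by positivity
  have hgrow : ∀ x ∈ X, ∀ w ∈ Y, m * ‖ys x - w‖ ^ 2 ≤ L x (ys x) - L x w := fun x hx w hw =>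
    (hstrong x hx).quadratic_growth hYconv (hysY x) (hysmax x) hw
  set κ₀ := α / (4 * Lyy) with hκ₀def
  have hκ₀ : 0 < κ₀ := by positivity
  set c := min κ₀ (1 / M) with hcdef
  have hc : 0 < c := lt_min hκ₀ (by positivity)
  set a := c / 6 * √m with hadef
  have ha : 0 < a := by positivity
  set b := c / 6 / DY with hbdef
  have hb : 0 < b := by positivity
  set ε := Lyx / √m with hεdef
  have hε : 0 < ε := by positivity
  set C₀ := Lxx + Lyx ^ 2 / (4 * m) with hC₀def
  have hC₀ : 0 ≤ C₀ := by positivity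
  set e := 2 * (ε * DX) with hedef
  have he : 0 ≤ e := by positivity
  set B := e * (e / a + 1) + (2 * C₀ + Lxx) * DX ^ 2 with hBdef
  have hB : 0 ≤ B := by positivity
  have hW0 : 0 ≤ W := (abs_nonneg _).trans (hW x₀ hx₀ y₀ hy₀)
  set S := 3 * (2 * (3 * W) + B) with hSdef
  have hS : 0 ≤ S := by positivity
  refine ⟨S + √(S / b) + 1, by positivity, ?_⟩
  intro K hK xseq yseq s p hx0 hy0 hs hxs hp hys
  set κ := (K : ℝ) ^ (-(1 : ℝ) / 4) with hκdef
  have hK0 : (0 : ℝ) < K := by exact_mod_cast (by omega : 0 < K)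
  have hK1 : (1 : ℝ) ≤ K := by exact_mod_cast (by omega : 1 ≤ K)
  have hκpos : 0 < κ := Real.rpow_pos_of_pos hK0 _
  have hκ1 : κ ≤ 1 := Real.rpow_le_one_of_one_le_of_nonpos hK1 (by norm_num)
  have hτ : (K : ℝ) ^ (-(3 : ℝ) / 4) = κ ^ 3 := by
    rw [hκdef, ← Real.rpow_mul_natCast hK0.le]; norm_num
  have hκ2 : (K : ℝ) ^ (-(1 : ℝ) / 2) = κ ^ 2 := by
    rw [hκdef, ← Real.rpow_mul_natCast hK0.le]; norm_num
  have hκ4 : (K : ℝ) * κ ^ 4 = 1 := by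
    have : κ ^ 4 = (K : ℝ) ^ (-1 : ℝ) := by
      rw [hκdef, ← Real.rpow_mul_natCast hK0.le]; norm_num
    rw [this, Real.rpow_neg_one, mul_inv_cancel₀ hK0.ne']
  rw [hτ] at hxs
  have hτ1 : κ ^ 3 ≤ 1 := pow_le_one₀ hκpos.le hκ1
  have hσ0 : ∀ k, 0 ≤ min 1 (κ₀ * ‖gradY L (xseq k) (yseq k)‖) := fun k =>
    le_min zero_le_one (by positivity)
  have hmem : ∀ k ≤ K, xseq k ∈ X ∧ yseq k ∈ Y := by
    intro k
    induction k with
    | zero => intro _; exact ⟨hx0 ▸ hx₀, hy0 ▸ hy₀⟩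
    | succ k ih =>
      intro hk
      obtain ⟨hxk, hyk⟩ := ih (by omega)
      rw [hxs k hk, hys k hk]
      exact ⟨hXconv (hs k hk).1 hxk (by positivity) (by linarith) (by ring),
        hYconv (hp k hk).1 hyk (hσ0 k) (sub_nonneg.2 (min_le_left _ _)) (by ring)⟩
  obtain ⟨t, ht1, ht2, ht⟩ := exists_le_of_telescoping_s9 hK
    (f := fun k => κ ^ 3 * ⟪gradX L (xseq k) (yseq k), xseq k - s k⟫
      + b * ⟪gradY L (xseq k) (yseq k), p k - yseq k⟫ ^ 2)
    (V := fun k => 2 * L (xseq k) (ys (xseq k)) - L (xseq k) (yseq k))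
    (W := 3 * W) (B := B) hκ4 (by
      intro k hk
      obtain ⟨hx, hy⟩ := hmem k hk.le
      obtain ⟨hx', hy'⟩ := hmem (k + 1) hk
      have hsk := (hs k hk).1
      obtain ⟨hpk, hpmax⟩ := hp k hk
      have hxk := hxs k hk
      have hyk := hys k hk
      have hσk := hσ0 k
      generalize xseq (k + 1) = x' at *
      generalize yseq (k + 1) = y' at *
      generalize xseq k = x at *
      generalize yseq k = y at *
      generalize s k = sk at *
      generalize p k = pk at *
      have hlip_y : ∀ z ∈ Y, ‖gradient (fun y => L x y) z - gradient (fun y => L x y) y‖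
          ≤ Lyy * ‖z - y‖ := fun z hz => by simpa using! hlipy x hx x hx z hz y hy
      have hgap := gap_ge_of_strongly_convex hYsc hy hpk hpmax
      have hdual : a * √(L x (ys x) - L x y) ^ 3 + b * ⟪gradY L x y, pk - y⟫ ^ 2
          ≤ L x y' - L x y := by
        have hasc := conditional_gradient_ascent (hLY x) hYconv hy hpk hLyy hlip_y hgap
          hσk (min_le_left _ _) (min_le_right _ _)
        rw [← hyk] at hasc
        have hG : L x (ys x) - L x y ≤ ⟪gradY L x y, ys x - y⟫ := by
          have : L x (ys x) ≤ L x y + ⟪gradY L x y, ys x - y⟫ :=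
            (hconc x hx).le_add_inner_gradient_s9 (hLY x) y (ys x)
          linarith
        have hGp : ⟪gradY L x y, ys x - y⟫ ≤ ⟪gradY L x y, pk - y⟫ := by
          rw [inner_sub_right, inner_sub_right]; linarith [hpmax _ (hysY x)]
        have hdec := suboptimality_decrease (h := L x (ys x) - L x y)
          (u := √(L x (ys x) - L x y)) (v := ‖ys x - y‖) (f' := L x y' - L x y) hm hκ₀ hM hDY
          (Real.sqrt_nonneg _) (norm_nonneg _) (hgM x hx y hy)
          (Real.sq_sqrt (sub_nonneg.2 (hysmax x y hy))).symm (hG.trans hGp)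
          (hG.trans (real_inner_le_norm _ _)) (hgrow x hx y hy)
          ((real_inner_le_norm _ _).trans
            (mul_le_mul_of_nonneg_left (hdY pk hpk y hy) (norm_nonneg _))) rfl
          (le_sub_iff_add_le'.2 hasc)
        refine le_trans (le_of_eq ?_) hdec
        rw [hadef, hbdef]
        ring
      have hxsub : x' - x = κ ^ 3 • (sk - x) := by rw [hxk]; module
      have hd : ‖x' - x‖ ≤ κ ^ 3 * DX := by
        rw [hxsub, norm_smul, Real.norm_of_nonneg (by positivity)]
        gcongr
        exact hdX sk hsk x hx
      have h1 := max_function_sub_le hXconv hLX hLxx hLyx hm hlipx hx hx' (hysY x') hy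
        (hgrow x hx)
      have h2 := max_function_sub_le hXconv hLX hLxx hLyx hm hlipx hx hx' (hysY x') hy'
        (hgrow x hx)
      have hux : √(L x (ys x) - L x y') ≤ √(L x (ys x) - L x y) := by
        apply Real.sqrt_le_sqrt
        have : 0 ≤ a * √(L x (ys x) - L x y) ^ 3 + b * ⟪gradY L x y, pk - y⟫ ^ 2 := by positivity
        linarith
      have h3 := abs_sub_sub_inner_le_of_norm_gradient_sub_le (hLX y') (c := gradX L x y')
        (x := x) (x' := x') (M := Lxx * ‖x' - x‖) (by
          intro w hw
          have := hlipx w (hXconv.segment_subset hx hx' hw) x hx y' hy' y' hy'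
          rw [sub_self, norm_zero, mul_zero, add_zero] at this
          exact this.trans (by gcongr; exact norm_sub_le_of_mem_segment hw))
      have h3' := (abs_le.1 h3).1
      have hinner : ⟪gradX L x y, x' - x⟫ = -(κ ^ 3 * ⟪gradX L x y, x - sk⟫) := by
        rw [hxsub, inner_smul_right, ← neg_sub x sk, inner_neg_right, mul_neg]
      rw [hinner] at h1
      set u := √(L x (ys x) - L x y)
      have hu : 0 ≤ u := Real.sqrt_nonneg _
      have hεd : ε * ‖x' - x‖ * u ≤ ε * (κ ^ 3 * DX) * u := by gcongr
      have hεd' : ε * ‖x' - x‖ * √(L x (ys x) - L x y') ≤ ε * (κ ^ 3 * DX) * u := by gcongr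
      have hquad : (2 * C₀ + Lxx) * ‖x' - x‖ ^ 2 ≤ (2 * C₀ + Lxx) * DX ^ 2 * κ ^ 4 := by
        calc (2 * C₀ + Lxx) * ‖x' - x‖ ^ 2 ≤ (2 * C₀ + Lxx) * (κ ^ 3 * DX) ^ 2 := by gcongr
          _ = (2 * C₀ + Lxx) * DX ^ 2 * κ ^ 6 := by ring
          _ ≤ (2 * C₀ + Lxx) * DX ^ 2 * κ ^ 4 := by
            gcongr ?_ * ?_
            exact pow_le_pow_of_le_one hκpos.le hκ1 (by norm_num)
      have habs := mul_pow_three_mul_le ha he hκpos.le hκ1 hu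
      have heu : e * κ ^ 3 * u = 2 * (ε * (κ ^ 3 * DX) * u) := by rw [hedef]; ring
      have hBκ : B * κ ^ 4 = e * (e / a + 1) * κ ^ 4 + (2 * C₀ + Lxx) * DX ^ 2 * κ ^ 4 := by
        rw [hBdef]; ring
      linarith) (by
      intro k hk
      obtain ⟨hx, hy⟩ := hmem k hk
      have h1 := abs_le.1 (hW _ hx _ hy)
      have h2 := abs_le.1 (hW _ hx _ (hysY (xseq k)))
      rw [abs_le]
      constructor <;> linarith [h1.1, h1.2, h2.1, h2.2]) hB
  obtain ⟨hsX, hsmin⟩ := hs t (by omega)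
  obtain ⟨hpY, hpmax⟩ := hp t (by omega)
  obtain ⟨hxt, hyt⟩ := hmem t (by omega)
  have hGX0 : 0 ≤ ⟪gradX L (xseq t) (yseq t), xseq t - s t⟫ := by
    rw [inner_sub_right]; linarith [hsmin _ hxt]
  have hGY0 : 0 ≤ ⟪gradY L (xseq t) (yseq t), p t - yseq t⟫ := by
    rw [inner_sub_right]; linarith [hpmax _ hyt]
  refine ⟨t, ht1, ht2, ?_, ?_⟩
  · refine csSup_le (hXne.image _) ?_
    rintro _ ⟨x', hx', rfl⟩
    have h1 : κ ^ 3 * ⟪gradX L (xseq t) (yseq t), xseq t - s t⟫ ≤ κ ^ 3 * (S * κ) := by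
      have : 0 ≤ b * ⟪gradY L (xseq t) (yseq t), p t - yseq t⟫ ^ 2 := by positivity
      calc _ ≤ S * κ ^ 4 := by linarith
        _ = _ := by ring
    have h2 := le_of_mul_le_mul_left h1 (by positivity)
    calc ⟪gradX L (xseq t) (yseq t), xseq t - x'⟫
        ≤ ⟪gradX L (xseq t) (yseq t), xseq t - s t⟫ := by
          rw [inner_sub_right, inner_sub_right]; linarith [hsmin _ hx']
      _ ≤ S * κ := h2
      _ ≤ (S + √(S / b) + 1) * κ := by gcongr; linarith [Real.sqrt_nonneg (S / b)]
  · refine csSup_le (hYne.image _) ?_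
    rintro _ ⟨y', hy', rfl⟩
    rw [hκ2]
    have h1 : b * ⟪gradY L (xseq t) (yseq t), p t - yseq t⟫ ^ 2 ≤ S * κ ^ 4 := by
      have : 0 ≤ κ ^ 3 * ⟪gradX L (xseq t) (yseq t), xseq t - s t⟫ := by positivity
      linarith
    have h2 : ⟪gradY L (xseq t) (yseq t), p t - yseq t⟫ ≤ √(S / b) * κ ^ 2 := by
      refine (abs_le_of_sq_le_sq' ?_ (by positivity)).2
      rw [mul_pow, Real.sq_sqrt (by positivity), div_mul_eq_mul_div, le_div_iff₀ hb]
      linarith [show S * (κ ^ 2) ^ 2 = S * κ ^ 4 by ring]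
    calc ⟪gradY L (xseq t) (yseq t), y' - yseq t⟫
        ≤ ⟪gradY L (xseq t) (yseq t), p t - yseq t⟫ := by
          rw [inner_sub_right, inner_sub_right]; linarith [hpmax _ hy']
      _ ≤ √(S / b) * κ ^ 2 := h2
      _ ≤ (S + √(S / b) + 1) * κ ^ 2 := by gcongr; linarith
end

section
/- Let Y ⊆ 𝒴 be a nonempty closed convex set, y₀ ∈ 𝒴, μ > 0 and L_yy ≥ 0. Let φ : 𝒴 → ℝ be differentiable and concave with L_yy-Lipschitz gradient, and set G(y) = ∇φ(y) − μ(y − y₀). Let 0 < σ ≤ 2/(L_yy + 2μ) and ρ = max{|1 − σ(L_yy + μ)|, |1 − σμ|}. Suppose y* ∈ Y satisfies ⟨G(y*), z − y*⟩ ≤ 0 for all z ∈ Y (equivalently y* = P_Y(y* + σ·G(y*))). Then for every y ∈ Y, ‖P_Y(y + σ·G(y)) − y*‖ ≤ ρ·‖y − y*‖. -/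
open scoped RealInnerProductSpace

section Gradient

variable {E : Type*} [NormedAddCommGroup E] [InnerProductSpace ℝ E] [CompleteSpace E]

theorem HasGradientAt.hasDerivAt_comp_add_smul {f : E → ℝ} {f' x v : E} {t : ℝ}
    (h : HasGradientAt f f' (x + t • v)) :
    HasDerivAt (fun s : ℝ => f (x + s • v)) ⟪f', v⟫ t := by
  have hline : HasDerivAt (fun s : ℝ => x + s • v) v t := by
    simpa using ((hasDerivAt_id t).smul_const v).const_add x
  simpa [Function.comp_def] using h.hasFDerivAt.comp_hasDerivAt t hline

/-- First-order characterization of convexity. -/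
theorem ConvexOn.add_inner_gradient_le {f : E → ℝ} {g : E → E} (hf : ConvexOn ℝ Set.univ f)
    (hg : ∀ x, HasGradientAt f (g x) x) (x z : E) :
    f x + ⟪g x, z - x⟫ ≤ f z := by
  have hline : ConvexOn ℝ Set.univ (fun s : ℝ => f (x + s • (z - x))) := by
    refine ⟨convex_univ, fun a _ b _ p q hp hq hpq => ?_⟩
    have h := hf.2 (Set.mem_univ (x + a • (z - x))) (Set.mem_univ (x + b • (z - x))) hp hq hpq
    convert h using 2
    obtain rfl : q = 1 - p := by linarith
    simp only [smul_eq_mul]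
    module
  have hderiv : HasDerivAt (fun s : ℝ => f (x + s • (z - x))) ⟪g x, z - x⟫ 0 :=
    HasGradientAt.hasDerivAt_comp_add_smul (by simpa using hg x)
  have h := hline.le_slope_of_hasDerivAt (Set.mem_univ 0) (Set.mem_univ 1) one_pos hderiv
  simp [slope_def_field] at h
  linarith

/-- Quadratic upper bound for a function with Lipschitz gradient. -/
theorem le_add_inner_gradient_add_sq {f : E → ℝ} {g : E → E} {L : ℝ}
    (hg : ∀ x, HasGradientAt f (g x) x) (hL : ∀ x y, ‖g x - g y‖ ≤ L * ‖x - y‖) (x v : E) :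
    f (x + v) ≤ f x + ⟪g x, v⟫ + L / 2 * ‖v‖ ^ 2 := by
  have hderiv : ∀ t : ℝ, HasDerivAt
      (fun s : ℝ => f (x + s • v) - s * ⟪g x, v⟫ - s ^ 2 * (L / 2 * ‖v‖ ^ 2))
      (⟪g (x + t • v), v⟫ - ⟪g x, v⟫ - 2 * t * (L / 2 * ‖v‖ ^ 2)) t := by
    intro t
    have h1 := (hg (x + t • v)).hasDerivAt_comp_add_smul
    have h2 := (hasDerivAt_id t).mul_const ⟪g x, v⟫
    have h3 := (hasDerivAt_pow 2 t).mul_const (L / 2 * ‖v‖ ^ 2)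
    simpa using (h1.fun_sub h2).fun_sub h3
  have hanti : AntitoneOn
      (fun s : ℝ => f (x + s • v) - s * ⟪g x, v⟫ - s ^ 2 * (L / 2 * ‖v‖ ^ 2)) (Set.Icc 0 1) := by
    refine antitoneOn_of_deriv_nonpos (convex_Icc 0 1)
      (fun t _ => (hderiv t).continuousAt.continuousWithinAt)
      (fun t _ => (hderiv t).differentiableAt.differentiableWithinAt) fun t ht => ?_
    rw [(hderiv t).deriv, ← inner_sub_left]
    rw [interior_Icc] at ht
    have h1 := real_inner_le_norm (g (x + t • v) - g x) v
    have h2 := mul_le_mul_of_nonneg_right (hL (x + t • v) x) (norm_nonneg v)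
    rw [add_sub_cancel_left, norm_smul, Real.norm_of_nonneg ht.1.le] at h2
    linarith
  have h := hanti (Set.left_mem_Icc.2 zero_le_one) (Set.right_mem_Icc.2 zero_le_one) zero_le_one
  simp at h
  linarith

/-- Baillon–Haddad: the Lipschitz gradient of a convex function is cocoercive. -/
theorem ConvexOn.norm_gradient_sub_sq_le {f : E → ℝ} {g : E → E} {L : ℝ} (hL0 : 0 ≤ L)
    (hf : ConvexOn ℝ Set.univ f) (hg : ∀ x, HasGradientAt f (g x) x)
    (hL : ∀ x y, ‖g x - g y‖ ≤ L * ‖x - y‖) (x y : E) :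
    ‖g x - g y‖ ^ 2 ≤ L * ⟪g x - g y, x - y⟫ := by
  rcases hL0.eq_or_lt with rfl | hpos
  · have h : ‖g x - g y‖ = 0 := le_antisymm (by simpa using hL x y) (norm_nonneg _)
    simp [h]
  have key : ∀ x y, ‖g y - g x‖ ^ 2 ≤ 2 * L * (f y - f x - ⟪g x, y - x⟫) := by
    intro x y
    have h1 := hf.add_inner_gradient_le hg x (y + (-L⁻¹) • (g y - g x))
    have h2 := le_add_inner_gradient_add_sq hg hL y ((-L⁻¹) • (g y - g x))
    rw [add_sub_right_comm, inner_add_right, inner_smul_right] at h1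
    rw [inner_smul_right, norm_smul, mul_pow, Real.norm_eq_abs, sq_abs] at h2
    have h3 : ⟪g y, g y - g x⟫ - ⟪g x, g y - g x⟫ = ‖g y - g x‖ ^ 2 := by
      rw [← inner_sub_left, real_inner_self_eq_norm_sq]
    have h4 : L / 2 * ((-L⁻¹) ^ 2 * ‖g y - g x‖ ^ 2) = L⁻¹ / 2 * ‖g y - g x‖ ^ 2 := by
      field_simp
    have h5 : L⁻¹ / 2 * ‖g y - g x‖ ^ 2 ≤ f y - f x - ⟪g x, y - x⟫ := by
      rw [h4] at h2
      rw [← h3] at h2 ⊢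
      linarith
    calc ‖g y - g x‖ ^ 2 = 2 * L * (L⁻¹ / 2 * ‖g y - g x‖ ^ 2) := by field_simp
      _ ≤ _ := by gcongr
  have h1 := key x y
  have h2 := key y x
  rw [norm_sub_rev] at h1
  have h3 : ⟪g x - g y, x - y⟫ = -⟪g x, y - x⟫ - ⟪g y, x - y⟫ := by
    rw [inner_sub_left, ← neg_sub x y, inner_neg_right, neg_neg]
  rw [h3]
  linarith

end Gradient

/-- Lemma `rho`, contraction of the regularized projected gradient-ascent map:
if `y*` is a fixed point of `y ↦ P_Y(y + σ·G(y))` with `G(y) = ∇φ(y) − μ(y − y₀)`, then the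
map is a `ρ`-contraction towards `y*`, with `ρ = max{|1 − σ(L_yy+μ)|, |1 − σμ|}`. -/
theorem stmt_11 {F : Type*}
    [NormedAddCommGroup F] [InnerProductSpace ℝ F] [FiniteDimensional ℝ F]
    (Y : Set F) (hYne : Y.Nonempty) (hYclosed : IsClosed Y) (hYconv : Convex ℝ Y)
    (P : F → F)
    (hP : ∀ u : F, P u ∈ Y ∧ ∀ z ∈ Y, ⟪u - P u, z - P u⟫ ≤ 0)
    (y₀ : F) (μ : ℝ) (hμ : 0 < μ) (Lyy : ℝ) (hLyy : 0 ≤ Lyy)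
    (φ : F → ℝ) (hφ : Differentiable ℝ φ) (hconc : ConcaveOn ℝ Set.univ φ)
    (hlip : ∀ y y' : F, ‖gradient φ y - gradient φ y'‖ ≤ Lyy * ‖y - y'‖)
    (σ : ℝ) (hσ0 : 0 < σ) (hσ : σ ≤ 2 / (Lyy + 2 * μ))
    (ρ : ℝ) (hρ : ρ = max |1 - σ * (Lyy + μ)| |1 - σ * μ|)
    (ystar : F) (hysY : ystar ∈ Y)
    (hopt : ∀ z ∈ Y, ⟪gradient φ ystar - μ • (ystar - y₀), z - ystar⟫ ≤ 0) :
    ∀ y ∈ Y, ‖P (y + σ • (gradient φ y - μ • (y - y₀))) - ystar‖ ≤ ρ * ‖y - ystar‖ := by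
  intro y _
  have hgrad : ∀ x, HasGradientAt (-φ) (-gradient φ x) x := fun x => by
    rw [hasGradientAt_iff_hasFDerivAt, map_neg]
    exact (hφ x).hasGradientAt.hasFDerivAt.neg
  have hcoco := hconc.neg.norm_gradient_sub_sq_le hLyy hgrad
    (fun x z => by rw [← neg_sub', norm_neg]; exact hlip x z) y ystar
  set d := y - ystar with hd
  set e := -gradient φ y - -gradient φ ystar with he
  set u := y + σ • (gradient φ y - μ • (y - y₀)) with hu
  have hmono : 0 ≤ ⟪e, d⟫ := by
    have h1 := hconc.neg.add_inner_gradient_le hgrad y ystar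
    have h2 := hconc.neg.add_inner_gradient_le hgrad ystar y
    rw [← neg_sub y ystar, inner_neg_right] at h1
    rw [he, inner_sub_left, hd]
    linarith
  have hσ' : σ * (Lyy + 2 * μ) ≤ 2 := (le_div_iff₀ (by positivity)).1 hσ
  have hσμ : 0 ≤ 1 - σ * μ := by nlinarith [mul_nonneg hσ0.le hLyy]
  have hstep : ‖(1 - σ * μ) • d - σ • e‖ ≤ (1 - σ * μ) * ‖d‖ := by
    refine le_of_sq_le_sq ?_ (by positivity)
    rw [norm_sub_sq_real, norm_smul, norm_smul, real_inner_smul_left, real_inner_smul_right,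
      real_inner_comm, Real.norm_of_nonneg hσμ, Real.norm_of_nonneg hσ0.le]
    nlinarith [mul_le_mul_of_nonneg_left hcoco (sq_nonneg σ),
      mul_nonneg (mul_nonneg hσ0.le hmono) (sub_nonneg.2 hσ')]
  have hproj : ‖P u - ystar‖ ≤ ‖(1 - σ * μ) • d - σ • e‖ := by
    have h1 := (hP u).2 ystar hysY
    have h2 := mul_nonpos_of_nonneg_of_nonpos hσ0.le (hopt (P u) (hP u).1)
    have h3 := real_inner_le_norm ((1 - σ * μ) • d - σ • e) (P u - ystar)
    have h4 : ⟪(1 - σ * μ) • d - σ • e, P u - ystar⟫ = ‖P u - ystar‖ ^ 2 - ⟪u - P u, ystar - P u⟫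
        - σ * ⟪gradient φ ystar - μ • (ystar - y₀), P u - ystar⟫ := by
      have hw : (1 - σ * μ) • d - σ • e = (P u - ystar) + (u - P u)
          - σ • (gradient φ ystar - μ • (ystar - y₀)) := by
        rw [hd, he, hu]
        module
      rw [hw, inner_sub_left, inner_add_left, real_inner_self_eq_norm_sq, real_inner_smul_left,
        ← neg_sub (P u) ystar, inner_neg_right]
      ring
    by_contra! hlt
    nlinarith [norm_nonneg ((1 - σ * μ) • d - σ • e)]
  calc ‖P u - ystar‖ ≤ (1 - σ * μ) * ‖d‖ := hproj.trans hstep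
    _ ≤ ρ * ‖d‖ := by
      gcongr
      rw [hρ]
      exact (le_abs_self _).trans (le_max_right _ _)
end
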